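/- arXiv:2004.03908 — 3 statements merged into one kernel-verified Lean document; each statement's English description precedes it below -/
import Mathlib

section
/- Let α ∈ (0, d/k], ε ∈ (0,1), λ > 0, T > 0 and p ∈ (max(2/α, k), ∞). Suppose U satisfies the Duhamel inequality on (0,T] with data U₀ and constant C₀, and let U_a be the associated Gevrey-weighted function. Then there exists a constant C_{k,ε} > 0, depending only on d, N, k, β, p, ε and C₀ (but not on λ, T, U or U₀), such that ‖U_a‖_{K^p_T} ≤ ‖e^{εtΔ}U₀‖_{K^p_T} + C_{k,ε} ( e^{λ²/(4(1−ε))} ‖U_a‖_{K^p_T} )^{k−1} ‖U_a‖_{K^p_T}, where ‖e^{εtΔ}U₀‖_{K^p_T} = sup_{0<t≤T} t^{1/p} ‖F^{−1}(e^{−εt|ξ|²}Û₀(ξ))‖_{Ḣ^{s_crit+2/p}}. -/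
open MeasureTheory Real Filter Topology
open scoped ENNReal NNReal

noncomputable section

/-- Euclidean space `ℝ^d`. -/
abbrev Rd (d : ℕ) := EuclideanSpace ℝ (Fin d)

/-- `ℂ^N` with the Euclidean norm. -/
abbrev CN (N : ℕ) := EuclideanSpace ℂ (Fin N)

/-- The homogeneous Sobolev norm `‖f‖_{Ḣ^s(ℝ^d)}` of a (vector-valued) function whose
Fourier transform is `g`:  `(∫ |ξ|^{2s} |g(ξ)|² dξ)^{1/2}`, valued in `ℝ≥0∞`. -/
def hSob (d N : ℕ) (s : ℝ) (g : Rd d → CN N) : ℝ≥0∞ :=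
  (∫⁻ ξ : Rd d, ENNReal.ofReal (‖ξ‖ ^ (2 * s) * ‖g ξ‖ ^ 2)) ^ (1/2 : ℝ)

/-- The same homogeneous Sobolev norm for a scalar nonnegative Fourier-side function. -/
def hSobR (d : ℕ) (s : ℝ) (g : Rd d → ℝ) : ℝ≥0∞ :=
  (∫⁻ ξ : Rd d, ENNReal.ofReal (‖ξ‖ ^ (2 * s) * g ξ ^ 2)) ^ (1/2 : ℝ)

/-- The same homogeneous Sobolev norm for a scalar complex Fourier-side function. -/
def hSobC (d : ℕ) (s : ℝ) (g : Rd d → ℂ) : ℝ≥0∞ :=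
  (∫⁻ ξ : Rd d, ENNReal.ofReal (‖ξ‖ ^ (2 * s) * ‖g ξ‖ ^ 2)) ^ (1/2 : ℝ)

/-- The Kato norm `‖U‖_{K^p_T} = sup_{0<t≤T} t^{1/p} ‖U(t)‖_{Ḣ^{s+2/p}}`,
for `U` given by its Fourier transform. -/
def kato (d N : ℕ) (s p T : ℝ) (U : ℝ → Rd d → CN N) : ℝ≥0∞ :=
  ⨆ t ∈ Set.Ioc (0:ℝ) T, ENNReal.ofReal (t ^ (1/p)) * hSob d N (s + 2/p) (U t)

/-- The Kato norm for a scalar nonnegative Fourier-side function of time. -/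
def katoR (d : ℕ) (s p T : ℝ) (g : ℝ → Rd d → ℝ) : ℝ≥0∞ :=
  ⨆ t ∈ Set.Ioc (0:ℝ) T, ENNReal.ofReal (t ^ (1/p)) * hSobR d (s + 2/p) (g t)

/-- Fourier multiplier of the heat flow `e^{aΔ}` applied to (the Fourier transform) `g`. -/
def heatHat (d N : ℕ) (a : ℝ) (g : Rd d → CN N) : Rd d → CN N :=
  fun ξ => Real.exp (-(a * ‖ξ‖ ^ 2)) • g ξ

/-- The Kato norm `sup_{0<τ≤T} τ^{1/p} ‖e^{ντΔ}U₀‖_{Ḣ^{s+2/p}}` of the heat flow. -/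
def heatKato (d N : ℕ) (ν s p T : ℝ) (g : Rd d → CN N) : ℝ≥0∞ :=
  ⨆ τ ∈ Set.Ioc (0:ℝ) T, ENNReal.ofReal (τ ^ (1/p)) * hSob d N (s + 2/p) (heatHat d N (ν * τ) g)

/-- The Gevrey-weighted modulus of the Fourier transform of `U`:
`Û_a(t,ξ) = e^{-λ²t/(4(1-ε)T) + λt|ξ|/√T} |Û(t,ξ)|`. -/
def gevreyHat (d N : ℕ) (ε lam T : ℝ) (U : ℝ → Rd d → CN N) : ℝ → Rd d → ℝ :=
  fun t ξ =>
    Real.exp (-(lam ^ 2 * t) / (4 * (1 - ε) * T) + lam * t * ‖ξ‖ / Real.sqrt T) * ‖U t ξ‖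

/-- `convIter d g n` is the `(n+1)`-fold convolution `g ⋆ ⋯ ⋆ g` of a nonnegative function. -/
def convIter (d : ℕ) (g : Rd d → ℝ≥0∞) : ℕ → Rd d → ℝ≥0∞
  | 0 => g
  | n + 1 => fun ξ => ∫⁻ η : Rd d, g η * convIter d g n (ξ - η)

/-- The Fourier-side Duhamel inequality: for all `t ∈ (0,T]` and `ξ`,
`|Û(t,ξ)| ≤ e^{-t|ξ|²}|Û₀(ξ)| + C₀ ∫₀ᵗ e^{-(t-t')|ξ|²} |ξ|^β (|Û(t')|⋆⋯⋆|Û(t')|)(ξ) dt'`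
(with a `k`-fold convolution). -/
def DuhamelIneq (d N k : ℕ) (β C₀ T : ℝ) (U₀ : Rd d → CN N) (U : ℝ → Rd d → CN N) : Prop :=
  ∀ t ∈ Set.Ioc (0:ℝ) T, ∀ ξ : Rd d,
    ENNReal.ofReal ‖U t ξ‖ ≤
      ENNReal.ofReal (Real.exp (-(t * ‖ξ‖ ^ 2)) * ‖U₀ ξ‖) +
        ENNReal.ofReal C₀ *
          ∫⁻ t' in Set.Ioc (0:ℝ) t,
            ENNReal.ofReal (Real.exp (-((t - t') * ‖ξ‖ ^ 2)) * ‖ξ‖ ^ β) *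
              convIter d (fun η => ENNReal.ofReal ‖U t' η‖) (k - 1) ξ

/-- Lower bound `R` for the radius of spatial analyticity of a function whose Fourier
transform is `g`: `R = sup{ρ ≥ 0 : ∫ e^{2ρ|ξ|} |ξ|^{2s} |g(ξ)|² dξ < ∞}`. -/
def anaRadius (d N : ℕ) (s : ℝ) (g : Rd d → CN N) : ℝ≥0∞ :=
  ⨆ ρ ∈ {ρ : ℝ | 0 ≤ ρ ∧
      (∫⁻ ξ : Rd d, ENNReal.ofReal (Real.exp (2 * ρ * ‖ξ‖) * ‖ξ‖ ^ (2 * s) * ‖g ξ‖ ^ 2)) < ⊤},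
    ENNReal.ofReal ρ

/-- The convolution of `n+1` complex-valued functions on `ℝ^d`. -/
def multiConvC (d n : ℕ) (g : Fin (n + 1) → Rd d → ℂ) (ξ : Rd d) : ℂ :=
  ∫ η : Fin n → Rd d, (∏ i : Fin n, g i.castSucc (η i)) * g (Fin.last n) (ξ - ∑ i, η i)

/-- A symbol which is continuous away from `0` and homogeneous of degree `β`. -/
def SymbolHomog (d : ℕ) (β : ℝ) (a : Rd d → ℂ) : Prop :=
  ContinuousOn a {ξ : Rd d | ξ ≠ 0} ∧
    ∀ μ : ℝ, 0 < μ → ∀ ξ : Rd d, ξ ≠ 0 → a (μ • ξ) = ((μ ^ β : ℝ) : ℂ) * a ξ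

/-- Fourier-side formulation of a mild solution of (SP) on `(0,T]`, with nonlinearity of
order `k = K+1` given by symbols `a j m` (indexed by the choice `m` of the component of `U`
appearing in each of the `k` factors, an equivalent parametrization of the multi-indices
`ℓ ∈ ℕ^N`, `|ℓ| = k`):
`Û_j(t,ξ) = e^{-t|ξ|²} Û₀_j(ξ) + ∫₀ᵗ e^{-(t-t')|ξ|²} Σ_m a_{j,m}(ξ) (2π)^{-dK} (Û_{m 0} ⋆ ⋯ ⋆ Û_{m K})(ξ) dt'`. -/
def IsMildSolSP (d N K : ℕ) (T : ℝ) (a : Fin N → (Fin (K + 1) → Fin N) → Rd d → ℂ)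
    (U₀ : Rd d → CN N) (U : ℝ → Rd d → CN N) : Prop :=
  ∀ t ∈ Set.Ioc (0:ℝ) T, ∀ ξ : Rd d, ∀ j : Fin N,
    U t ξ j = (Real.exp (-(t * ‖ξ‖ ^ 2)) : ℂ) * U₀ ξ j +
      (((2 * Real.pi) ^ (d * K) : ℝ) : ℂ)⁻¹ *
        ∫ t' in Set.Ioc (0:ℝ) t,
          (Real.exp (-((t - t') * ‖ξ‖ ^ 2)) : ℂ) *
            ∑ m : Fin (K + 1) → Fin N, a j m ξ * multiConvC d K (fun i η => U t' η (m i)) ξ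



theorem aux_pw (r R : ℝ) (hr : -1 < r) (hR : 0 ≤ R) :
    ∫⁻ y in Set.Ioc (0:ℝ) R, ENNReal.ofReal (y ^ r) = ENNReal.ofReal (R ^ (r+1) / (r+1)) := by
  have hi := intervalIntegral.intervalIntegrable_rpow' (a := 0) (b := R) hr
  rw [intervalIntegrable_iff_integrableOn_Ioc_of_le hR] at hi
  rw [← ofReal_integral_eq_lintegral_ofReal hi]
  · rw [← intervalIntegral.integral_of_le hR, integral_rpow (Or.inl hr)]
    rw [Real.zero_rpow (by linarith), sub_zero]
  · filter_upwards [self_mem_ae_restrict measurableSet_Ioc] with y hy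
    exact Real.rpow_nonneg hy.1.le _

theorem aux_cs {X : Type*} [MeasurableSpace X] (μ : Measure X) (f g : X → ℝ≥0∞)
    (hf : AEMeasurable f μ) (hg : AEMeasurable g μ) :
    (∫⁻ x, f x * g x ∂μ) ^ 2 ≤ (∫⁻ x, f x ^ 2 ∂μ) * ∫⁻ x, g x ^ 2 ∂μ := by
  have h := ENNReal.lintegral_mul_le_Lp_mul_Lq μ Real.HolderConjugate.two_two hf hg
  have h2 := pow_le_pow_left' h 2
  refine h2.trans (le_of_eq ?_)
  rw [mul_pow]
  simp only [← ENNReal.rpow_natCast, ← ENNReal.rpow_mul]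
  norm_num

def kap (d : ℕ) (a : ℝ) (R y : ℝ) : ℝ :=
  if y ≤ R then y ^ (a - (d:ℝ)/2) * R ^ (-a) else 0

theorem kap_nonneg (d : ℕ) (a R y : ℝ) (hy : 0 ≤ y) (hR : 0 ≤ R) : 0 ≤ kap d a R y := by
  unfold kap; split_ifs <;> positivity

theorem kap_meas (d : ℕ) (a : ℝ) : Measurable (fun q : ℝ × ℝ => kap d a q.1 q.2) := by
  unfold kap
  refine Measurable.ite (measurableSet_le measurable_snd measurable_fst) ?_ measurable_const
  fun_prop

theorem aux_kap (d : ℕ) (hd : 1 ≤ d) (a : ℝ) (ha : 0 < a) :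
    ∃ A : ℝ≥0∞, A ≠ ⊤ ∧ ∀ R : ℝ, 0 ≤ R →
      ∫⁻ η : Rd d, ENNReal.ofReal (kap d a R ‖η‖) ^ 2 ≤ A := by
  have : Nonempty (Fin d) := ⟨⟨0, hd⟩⟩
  have : Nontrivial (Rd d) := inferInstance
  refine ⟨ENNReal.ofReal (d * (volume.real (Metric.ball (0 : Rd d) 1) * (1 / (2 * a)))),
    ENNReal.ofReal_ne_top, fun R hR => ?_⟩
  rcases hR.eq_or_lt with rfl | hR
  · have : ∀ y, kap d a 0 y = 0 := by
      intro y; unfold kap; rw [Real.zero_rpow (by linarith)]; simp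
    simp [this]
  have hdim : Module.finrank ℝ (Rd d) = d := by simp
  have key : Set.EqOn (fun y : ℝ => y ^ (Module.finrank ℝ (Rd d) - 1) • (kap d a R y ^ 2))
      ((Set.Ioc 0 R).indicator (fun y => y ^ (2 * a - 1) * R ^ (-(2 * a)))) (Set.Ioi 0) := by
    intro y hy
    have hy : 0 < y := hy
    rw [hdim]
    simp only [Set.indicator, Set.mem_Ioc, hy, true_and, kap, smul_eq_mul]
    split_ifs with h
    · rw [mul_pow, ← mul_assoc, ← Real.rpow_natCast, ← Real.rpow_natCast, ← Real.rpow_natCast,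
        ← Real.rpow_mul hy.le, ← Real.rpow_mul hR.le, ← Real.rpow_add hy]
      congr 2
      · push_cast [Nat.cast_sub hd]; ring
      · push_cast; ring
    · simp
  have hii : IntegrableOn (fun y => y ^ (2 * a - 1) * R ^ (-(2 * a))) (Set.Ioc 0 R) := by
    have hi := intervalIntegral.intervalIntegrable_rpow' (a := 0) (b := R)
      (show -1 < 2 * a - 1 by linarith)
    rw [intervalIntegrable_iff_integrableOn_Ioc_of_le hR.le] at hi
    exact hi.mul_const _
  have hint : Integrable (fun η : Rd d => kap d a R ‖η‖ ^ 2) volume := by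
    rw [integrable_fun_norm_addHaar volume (f := fun y => kap d a R y ^ 2),
      integrableOn_congr_fun key measurableSet_Ioi]
    exact ((integrable_indicator_iff measurableSet_Ioc).2 hii).integrableOn
  have h1 : ∀ η : Rd d, ENNReal.ofReal (kap d a R ‖η‖) ^ 2 = ENNReal.ofReal (kap d a R ‖η‖ ^ 2) :=
    fun η => (ENNReal.ofReal_pow (kap_nonneg d a R _ (norm_nonneg _) hR.le) 2).symm
  simp only [h1]
  rw [← ofReal_integral_eq_lintegral_ofReal hint (ae_of_all _ fun _ => sq_nonneg _)]
  apply ENNReal.ofReal_le_ofReal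
  rw [integral_fun_norm_addHaar volume (fun y => kap d a R y ^ 2),
    setIntegral_congr_fun measurableSet_Ioi key, setIntegral_indicator measurableSet_Ioc]
  have h2 : Set.Ioi (0:ℝ) ∩ Set.Ioc 0 R = Set.Ioc 0 R := by
    ext y; simp +contextual
  rw [h2, integral_mul_const, ← intervalIntegral.integral_of_le hR.le,
    integral_rpow (Or.inl (by linarith)), hdim, Real.zero_rpow (by linarith)]
  rw [Real.rpow_neg hR.le]
  have : R ^ (2 * a) ≠ 0 := (Real.rpow_pos_of_pos hR _).ne'
  simp only [nsmul_eq_mul, smul_eq_mul, sub_add_cancel]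
  apply le_of_eq
  field_simp
  ring

theorem aux_comp (r y z : ℝ) (hy : 0 < y) (hz : 0 < z) (h1 : y ≤ 2 * z) (h2 : z ≤ 2 * y) :
    y ^ r ≤ 2 ^ |r| * z ^ r := by
  rcases le_or_gt 0 r with h | h
  · rw [abs_of_nonneg h, ← Real.mul_rpow (by norm_num) hz.le]
    exact Real.rpow_le_rpow hy.le h1 h
  · rw [abs_of_neg h, Real.rpow_neg (by norm_num), ← Real.inv_rpow (by norm_num),
      ← Real.mul_rpow (by norm_num) hz.le]
    apply Real.rpow_le_rpow_of_nonpos (by positivity) _ h.le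
    linarith

theorem aux_ker (d : ℕ) (a b x y z : ℝ) (hx : 0 < x) (hy : 0 < y) (hz : 0 < z)
    (h1 : x ≤ y + z) (h2 : y ≤ x + z) (h3 : z ≤ x + y) :
    z ^ ((d:ℝ)/2 - (a+b)) ≤ (2 ^ |a - (d:ℝ)/2| + 2 ^ |b - (d:ℝ)/2|) *
      (kap d a z x + kap d b z y + kap d (d - (a+b)) x z) *
        (x ^ ((d:ℝ)/2 - a) * y ^ ((d:ℝ)/2 - b)) := by
  have n1 := kap_nonneg d a z x hx.le hz.le
  have n2 := kap_nonneg d b z y hy.le hz.le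
  have n3 := kap_nonneg d (d-(a+b)) x z hz.le hx.le
  have p1 : (0:ℝ) < 2 ^ |a - (d:ℝ)/2| := by positivity
  have p2 : (0:ℝ) < 2 ^ |b - (d:ℝ)/2| := by positivity
  have px : 0 < x ^ ((d:ℝ)/2 - a) := by positivity
  have py : 0 < y ^ ((d:ℝ)/2 - b) := by positivity
  have ix : x ^ (a - (d:ℝ)/2) * x ^ ((d:ℝ)/2 - a) = 1 := by
    rw [← Real.rpow_add hx]; simp
  have iy : y ^ (b - (d:ℝ)/2) * y ^ ((d:ℝ)/2 - b) = 1 := by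
    rw [← Real.rpow_add hy]; simp
  suffices h : z ^ ((d:ℝ)/2 - (a+b)) * (x ^ (a - (d:ℝ)/2) * y ^ (b - (d:ℝ)/2)) ≤
      (2 ^ |a - (d:ℝ)/2| + 2 ^ |b - (d:ℝ)/2|) *
      (kap d a z x + kap d b z y + kap d (d - (a+b)) x z) by
    calc z ^ ((d:ℝ)/2 - (a+b)) = z ^ ((d:ℝ)/2 - (a+b)) * ((x ^ (a - (d:ℝ)/2) * x ^ ((d:ℝ)/2 - a)) * (y ^ (b - (d:ℝ)/2) * y ^ ((d:ℝ)/2 - b))) := by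
          rw [ix, iy]; ring
      _ = (z ^ ((d:ℝ)/2 - (a+b)) * (x ^ (a - (d:ℝ)/2) * y ^ (b - (d:ℝ)/2))) * (x ^ ((d:ℝ)/2 - a) * y ^ ((d:ℝ)/2 - b)) := by ring
      _ ≤ _ := by gcongr
  by_cases c1 : x ≤ y ∧ x ≤ z
  · have hc := aux_comp (b - (d:ℝ)/2) y z hy hz (by linarith) (by linarith)
    have hk : kap d a z x = x ^ (a - (d:ℝ)/2) * z ^ (-a) := if_pos c1.2
    calc _ ≤ z ^ ((d:ℝ)/2 - (a+b)) * (x ^ (a - (d:ℝ)/2) * (2 ^ |b - (d:ℝ)/2| * z ^ (b - (d:ℝ)/2))) := by gcongr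
      _ = 2 ^ |b - (d:ℝ)/2| * (x ^ (a - (d:ℝ)/2) * (z ^ ((d:ℝ)/2 - (a+b)) * z ^ (b - (d:ℝ)/2))) := by ring
      _ = 2 ^ |b - (d:ℝ)/2| * kap d a z x := by
          rw [hk, ← Real.rpow_add hz]; congr 3; ring
      _ ≤ _ := by
          apply mul_le_mul <;> linarith
  by_cases c2 : y ≤ x ∧ y ≤ z
  · have hc := aux_comp (a - (d:ℝ)/2) x z hx hz (by linarith) (by linarith)
    have hk : kap d b z y = y ^ (b - (d:ℝ)/2) * z ^ (-b) := if_pos c2.2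
    calc _ ≤ z ^ ((d:ℝ)/2 - (a+b)) * ((2 ^ |a - (d:ℝ)/2| * z ^ (a - (d:ℝ)/2)) * y ^ (b - (d:ℝ)/2)) := by gcongr
      _ = 2 ^ |a - (d:ℝ)/2| * (y ^ (b - (d:ℝ)/2) * (z ^ ((d:ℝ)/2 - (a+b)) * z ^ (a - (d:ℝ)/2))) := by ring
      _ = 2 ^ |a - (d:ℝ)/2| * kap d b z y := by
          rw [hk, ← Real.rpow_add hz]; congr 3; ring
      _ ≤ _ := by
          apply mul_le_mul <;> linarith
  have c3 : z ≤ x ∧ z ≤ y := by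
    constructor <;> by_contra hcon <;> push Not at * <;>
      rcases le_total x y with h | h <;> first | (have := c1 h; linarith) | (have := c2 h; linarith)
  have hc := aux_comp (b - (d:ℝ)/2) y x hy hx (by linarith) (by linarith)
  have hk : kap d (d - (a+b)) x z = z ^ ((d - (a+b)) - (d:ℝ)/2) * x ^ (-((d:ℝ) - (a+b))) := if_pos c3.1
  calc _ ≤ z ^ ((d:ℝ)/2 - (a+b)) * (x ^ (a - (d:ℝ)/2) * (2 ^ |b - (d:ℝ)/2| * x ^ (b - (d:ℝ)/2))) := by gcongr
    _ = 2 ^ |b - (d:ℝ)/2| * (z ^ ((d:ℝ)/2 - (a+b)) * (x ^ (a - (d:ℝ)/2) * x ^ (b - (d:ℝ)/2))) := by ring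
    _ = 2 ^ |b - (d:ℝ)/2| * kap d (d - (a+b)) x z := by
        rw [hk, ← Real.rpow_add hx]; congr 3 <;> ring
    _ ≤ _ := by
        apply mul_le_mul <;> linarith

def wt (d : ℕ) (s : ℝ) (ξ : Rd d) : ℝ≥0∞ := ENNReal.ofReal (‖ξ‖ ^ s)

theorem wt_meas (d : ℕ) (s : ℝ) : Measurable (wt d s) := by
  unfold wt; fun_prop

theorem aux_sq3 (x y z : ℝ≥0∞) : (x + y + z) ^ 2 ≤ 9 * (x ^ 2 + y ^ 2 + z ^ 2) := by
  have key : ∀ m : ℝ≥0∞, x ≤ m → y ≤ m → z ≤ m → m ^ 2 ≤ x ^ 2 + y ^ 2 + z ^ 2 →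
      (x + y + z) ^ 2 ≤ 9 * (x ^ 2 + y ^ 2 + z ^ 2) := by
    intro m h1 h2 h3 h4
    calc (x + y + z) ^ 2 ≤ (m + m + m) ^ 2 := by gcongr
      _ = 9 * m ^ 2 := by ring
      _ ≤ _ := by gcongr
  rcases le_total x y with h | h <;> rcases le_total y z with h' | h' <;>
    rcases le_total x z with h'' | h''
  · exact key z h'' h' le_rfl le_add_self
  · exact key z (h.trans h') h' le_rfl le_add_self
  · exact key y h le_rfl h' (le_add_right le_add_self)
  · exact key y h le_rfl h' (le_add_right le_add_self)
  · exact key z h'' h' le_rfl le_add_self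
  · exact key x le_rfl h h'' (le_add_right le_self_add)
  · exact key x le_rfl h (h'.trans h) (le_add_right le_self_add)
  · exact key x le_rfl h h'' (le_add_right le_self_add)

theorem aux_conv_sq (d : ℕ) (f g : Rd d → ℝ≥0∞) (hf : Measurable f) (hg : Measurable g) :
    ∫⁻ ξ : Rd d, ∫⁻ η : Rd d, (f η * g (ξ - η)) ^ 2 = (∫⁻ η, f η ^ 2) * ∫⁻ η, g η ^ 2 := by
  rw [lintegral_lintegral_swap (by fun_prop)]
  simp only [mul_pow]
  have : ∀ η : Rd d, ∫⁻ ξ : Rd d, f η ^ 2 * g (ξ - η) ^ 2 = f η ^ 2 * ∫⁻ ξ, g ξ ^ 2 := by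
    intro η
    rw [lintegral_const_mul _ (by fun_prop), lintegral_sub_right_eq_self (fun x => g x ^ 2)]
  simp only [this]
  rw [lintegral_mul_const _ (by fun_prop)]

theorem aux_B1 (d : ℕ) (f g : Rd d → ℝ≥0∞) (mf : Measurable f) (mg : Measurable g)
    (κ : Rd d → Rd d → ℝ≥0∞) (m : Measurable (fun q : Rd d × Rd d => κ q.1 q.2)) (A : ℝ≥0∞)
    (H : ∀ ξ, ∫⁻ η, κ ξ η ^ 2 ≤ A) :
    ∫⁻ ξ, (∫⁻ η, κ ξ η * (f η * g (ξ - η))) ^ 2 ≤ A * ((∫⁻ η, f η ^ 2) * ∫⁻ η, g η ^ 2) := by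
  have m' : ∀ ξ, Measurable (κ ξ) := fun ξ => m.comp measurable_prodMk_left
  have mfg : ∀ ξ, Measurable (fun η => f η * g (ξ - η)) := fun ξ => by fun_prop
  have mfg2 : Measurable (fun q : Rd d × Rd d => f q.2 * g (q.1 - q.2)) := by fun_prop
  calc _ ≤ ∫⁻ ξ, A * ∫⁻ η, (f η * g (ξ - η)) ^ 2 := by
        apply lintegral_mono; intro ξ
        refine (aux_cs volume _ _ (m' ξ).aemeasurable (mfg ξ).aemeasurable).trans ?_
        exact mul_le_mul' (H ξ) le_rfl
    _ = _ := by
        rw [lintegral_const_mul _ ((mfg2.pow_const 2).lintegral_prod_right'), aux_conv_sq d f g mf mg]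

theorem aux_B3 (d : ℕ) (f g : Rd d → ℝ≥0∞) (mf : Measurable f) (mg : Measurable g)
    (κ : Rd d → Rd d → ℝ≥0∞) (m : Measurable (fun q : Rd d × Rd d => κ q.1 q.2)) (A : ℝ≥0∞)
    (H : ∀ η, ∫⁻ ξ, κ ξ η ^ 2 ≤ A) :
    ∫⁻ ξ, (∫⁻ η, κ ξ η * (f η * g (ξ - η))) ^ 2 ≤ A * ((∫⁻ η, f η ^ 2) * ∫⁻ η, g η ^ 2) := by
  have m' : ∀ ξ, Measurable (κ ξ) := fun ξ => m.comp measurable_prodMk_left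
  have mkf : Measurable (fun q : Rd d × Rd d => κ q.1 q.2 * f q.2) := m.mul (mf.comp measurable_snd)
  calc _ ≤ ∫⁻ ξ, (∫⁻ η, (κ ξ η * f η) ^ 2) * ∫⁻ η, g η ^ 2 := by
        apply lintegral_mono; intro ξ
        have h := aux_cs volume (fun η => κ ξ η * f η) (fun η => g (ξ - η))
          ((m' ξ).mul mf).aemeasurable (by fun_prop)
        rw [lintegral_sub_left_eq_self (fun η => g η ^ 2)] at h
        simpa only [mul_assoc] using h
    _ = (∫⁻ ξ, ∫⁻ η, (κ ξ η * f η) ^ 2) * ∫⁻ η, g η ^ 2 := by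
        rw [lintegral_mul_const _ ((mkf.pow_const 2).lintegral_prod_right')]
    _ = (∫⁻ η, ∫⁻ ξ, (κ ξ η * f η) ^ 2) * ∫⁻ η, g η ^ 2 := by
        rw [lintegral_lintegral_swap (mkf.pow_const 2).aemeasurable]
    _ ≤ (∫⁻ η, A * f η ^ 2) * ∫⁻ η, g η ^ 2 := by
        refine mul_le_mul' (lintegral_mono fun η => ?_) le_rfl
        simp only [mul_pow]
        have mm : Measurable (fun ξ => κ ξ η) := m.comp measurable_prodMk_right
        rw [lintegral_mul_const _ (mm.pow_const 2)]
        exact mul_le_mul' (H η) le_rfl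
    _ = _ := by
        rw [lintegral_const_mul _ (by fun_prop), mul_assoc]

theorem aux_comb (d : ℕ) (f g : Rd d → ℝ≥0∞) (mf : Measurable f) (mg : Measurable g)
    (κ1 κ2 κ3 : Rd d → Rd d → ℝ≥0∞)
    (m1 : Measurable (fun q : Rd d × Rd d => κ1 q.1 q.2))
    (m2 : Measurable (fun q : Rd d × Rd d => κ2 q.1 q.2))
    (m3 : Measurable (fun q : Rd d × Rd d => κ3 q.1 q.2)) (A1 A2 A3 D : ℝ≥0∞)
    (H1 : ∀ ξ, ∫⁻ η, κ1 ξ η ^ 2 ≤ A1) (H2 : ∀ ξ, ∫⁻ η, κ2 ξ η ^ 2 ≤ A2)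
    (H3 : ∀ η, ∫⁻ ξ, κ3 ξ η ^ 2 ≤ A3)
    (Φ : Rd d → ℝ≥0∞)
    (hΦ : ∀ᵐ ξ, Φ ξ ≤ ∫⁻ η, D * (κ1 ξ η + κ2 ξ η + κ3 ξ η) * (f η * g (ξ - η))) :
    ∫⁻ ξ, Φ ξ ^ 2 ≤ D ^ 2 * 9 * (A1 + A2 + A3) * ((∫⁻ η, f η ^ 2) * ∫⁻ η, g η ^ 2) := by
  have B1 := aux_B1 d f g mf mg κ1 m1 A1 H1
  have B2 := aux_B1 d f g mf mg κ2 m2 A2 H2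
  have B3 := aux_B3 d f g mf mg κ3 m3 A3 H3
  have m1' : ∀ ξ, Measurable (κ1 ξ) := fun ξ => m1.comp measurable_prodMk_left
  have m2' : ∀ ξ, Measurable (κ2 ξ) := fun ξ => m2.comp measurable_prodMk_left
  have m3' : ∀ ξ, Measurable (κ3 ξ) := fun ξ => m3.comp measurable_prodMk_left
  have mfg : ∀ ξ, Measurable (fun η => f η * g (ξ - η)) := fun ξ => by fun_prop
  have mfg2 : Measurable (fun q : Rd d × Rd d => f q.2 * g (q.1 - q.2)) := by fun_prop
  have mI1 : Measurable (fun ξ => ∫⁻ η, κ1 ξ η * (f η * g (ξ - η))) :=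
    (m1.mul mfg2).lintegral_prod_right'
  have mI2 : Measurable (fun ξ => ∫⁻ η, κ2 ξ η * (f η * g (ξ - η))) :=
    (m2.mul mfg2).lintegral_prod_right'
  have mI3 : Measurable (fun ξ => ∫⁻ η, κ3 ξ η * (f η * g (ξ - η))) :=
    (m3.mul mfg2).lintegral_prod_right'
  have E : ∀ ξ, ∫⁻ η, D * (κ1 ξ η + κ2 ξ η + κ3 ξ η) * (f η * g (ξ - η)) =
      D * ((∫⁻ η, κ1 ξ η * (f η * g (ξ - η))) + (∫⁻ η, κ2 ξ η * (f η * g (ξ - η))) +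
        ∫⁻ η, κ3 ξ η * (f η * g (ξ - η))) := by
    intro ξ
    have q1 : Measurable (fun η => κ1 ξ η * (f η * g (ξ - η))) := (m1' ξ).mul (mfg ξ)
    have q2 : Measurable (fun η => κ2 ξ η * (f η * g (ξ - η))) := (m2' ξ).mul (mfg ξ)
    have q3 : Measurable (fun η => κ3 ξ η * (f η * g (ξ - η))) := (m3' ξ).mul (mfg ξ)
    rw [← lintegral_add_left q1, ← lintegral_add_left (by exact q1.add q2),
        ← lintegral_const_mul _ (by exact (q1.add q2).add q3)]
    congr 1
    funext η
    ring
  simp only [E] at hΦ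
  revert mI1 mI2 mI3 B1 B2 B3 hΦ
  generalize hI1 : (fun ξ => ∫⁻ η, κ1 ξ η * (f η * g (ξ - η))) = I1
  generalize hI2 : (fun ξ => ∫⁻ η, κ2 ξ η * (f η * g (ξ - η))) = I2
  generalize hI3 : (fun ξ => ∫⁻ η, κ3 ξ η * (f η * g (ξ - η))) = I3
  simp only [fun ξ => congrFun hI1 ξ, fun ξ => congrFun hI2 ξ, fun ξ => congrFun hI3 ξ]
  generalize (∫⁻ η, f η ^ 2) * ∫⁻ η, g η ^ 2 = Q
  intro B1 B2 B3 mI1 mI2 mI3 hΦ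
  calc _ ≤ ∫⁻ ξ, D ^ 2 * 9 * (I1 ξ ^ 2 + I2 ξ ^ 2 + I3 ξ ^ 2) := by
        apply lintegral_mono_ae
        filter_upwards [hΦ] with ξ h
        calc _ ≤ (D * (I1 ξ + I2 ξ + I3 ξ)) ^ 2 := pow_le_pow_left' h 2
          _ = D ^ 2 * (I1 ξ + I2 ξ + I3 ξ) ^ 2 := by ring
          _ ≤ D ^ 2 * (9 * (I1 ξ ^ 2 + I2 ξ ^ 2 + I3 ξ ^ 2)) := mul_le_mul' le_rfl (aux_sq3 _ _ _)
          _ = _ := by ring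
    _ = D ^ 2 * 9 * ((∫⁻ ξ, I1 ξ ^ 2) + (∫⁻ ξ, I2 ξ ^ 2) + ∫⁻ ξ, I3 ξ ^ 2) := by
        rw [lintegral_const_mul _ (by fun_prop), lintegral_add_left (by fun_prop),
          lintegral_add_left (by fun_prop)]
    _ ≤ D ^ 2 * 9 * (A1 * Q + A2 * Q + A3 * Q) :=
        mul_le_mul' le_rfl (add_le_add (add_le_add B1 B2) B3)
    _ = _ := by ring

theorem aux_pt (d : ℕ) (a b : ℝ) (F G : Rd d → ℝ≥0∞) (ξ η : Rd d) (hξ : ξ ≠ 0) (h0 : η ≠ 0)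
    (h1 : η ≠ ξ) :
    wt d ((d:ℝ)/2 - (a+b)) ξ * (F η * G (ξ - η)) ≤
      ENNReal.ofReal (2 ^ |a - (d:ℝ)/2| + 2 ^ |b - (d:ℝ)/2|) *
        (ENNReal.ofReal (kap d a ‖ξ‖ ‖η‖) + ENNReal.ofReal (kap d b ‖ξ‖ ‖ξ - η‖) +
          ENNReal.ofReal (kap d (d-(a+b)) ‖η‖ ‖ξ‖)) *
        ((wt d ((d:ℝ)/2 - a) η * F η) * (wt d ((d:ℝ)/2 - b) (ξ - η) * G (ξ - η))) := by
  have hz : 0 < ‖ξ‖ := norm_pos_iff.2 hξ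
  have hx : 0 < ‖η‖ := norm_pos_iff.2 h0
  have hy : 0 < ‖ξ - η‖ := norm_pos_iff.2 (sub_ne_zero.2 (Ne.symm h1))
  have t1 : ‖η‖ ≤ ‖ξ - η‖ + ‖ξ‖ := by
    have := norm_sub_le ξ (ξ - η); rw [sub_sub_cancel] at this; linarith
  have t2 : ‖ξ - η‖ ≤ ‖η‖ + ‖ξ‖ := by
    have := norm_sub_le ξ η; linarith
  have t3 : ‖ξ‖ ≤ ‖η‖ + ‖ξ - η‖ := by
    have := norm_add_le η (ξ - η); rw [add_sub_cancel] at this; linarith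
  have hker := ENNReal.ofReal_le_ofReal (aux_ker d a b _ _ _ hx hy hz t1 t2 t3)
  have n1 := kap_nonneg d a ‖ξ‖ ‖η‖ hx.le hz.le
  have n2 := kap_nonneg d b ‖ξ‖ ‖ξ - η‖ hy.le hz.le
  have n3 := kap_nonneg d (d-(a+b)) ‖η‖ ‖ξ‖ hz.le hx.le
  rw [ENNReal.ofReal_mul (by positivity), ENNReal.ofReal_mul (by positivity),
    ENNReal.ofReal_mul (by positivity), ENNReal.ofReal_add (by positivity) n3,
    ENNReal.ofReal_add n1 n2] at hker
  refine (mul_le_mul' hker le_rfl).trans (le_of_eq ?_)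
  unfold wt
  ring

theorem aux_conv2 (d : ℕ) (hd : 1 ≤ d) (a b : ℝ) (ha : 0 < a) (hb : 0 < b) (hab : a + b < d) :
    ∃ C : ℝ≥0∞, C ≠ ⊤ ∧ ∀ F G : Rd d → ℝ≥0∞, Measurable F → Measurable G →
      ∫⁻ ξ : Rd d, (wt d ((d:ℝ)/2 - (a+b)) ξ * ∫⁻ η : Rd d, F η * G (ξ - η)) ^ 2 ≤
        C * ((∫⁻ ξ, (wt d ((d:ℝ)/2 - a) ξ * F ξ) ^ 2) *
          ∫⁻ ξ, (wt d ((d:ℝ)/2 - b) ξ * G ξ) ^ 2) := by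
  have : Nonempty (Fin d) := ⟨⟨0, hd⟩⟩
  have : Nontrivial (Rd d) := inferInstance
  obtain ⟨A1, hA1, H1⟩ := aux_kap d hd a ha
  obtain ⟨A2, hA2, H2⟩ := aux_kap d hd b hb
  obtain ⟨A3, hA3, H3⟩ := aux_kap d hd (d - (a+b)) (by linarith)
  refine ⟨ENNReal.ofReal (2 ^ |a - (d:ℝ)/2| + 2 ^ |b - (d:ℝ)/2|) ^ 2 * 9 * (A1 + A2 + A3), ?_,
    fun F G hF hG => ?_⟩
  · refine ENNReal.mul_ne_top (ENNReal.mul_ne_top (ENNReal.pow_ne_top ENNReal.ofReal_ne_top) (by simp)) ?_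
    simp [hA1, hA2, hA3]
  have mk : ∀ c, Measurable (fun q : ℝ × ℝ => ENNReal.ofReal (kap d c q.1 q.2)) :=
    fun c => (kap_meas d c).ennreal_ofReal
  have hne : ∀ x : Rd d, ∀ᵐ η : Rd d, η ≠ x := by
    intro x; simp [ae_iff]
  refine aux_comb d (fun η => wt d ((d:ℝ)/2 - a) η * F η) (fun η => wt d ((d:ℝ)/2 - b) η * G η)
    ((wt_meas d _).mul hF) ((wt_meas d _).mul hG)
    (fun ξ η => ENNReal.ofReal (kap d a ‖ξ‖ ‖η‖))
    (fun ξ η => ENNReal.ofReal (kap d b ‖ξ‖ ‖ξ - η‖))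
    (fun ξ η => ENNReal.ofReal (kap d (d-(a+b)) ‖η‖ ‖ξ‖))
    ((mk a).comp (measurable_fst.norm.prodMk measurable_snd.norm))
    ((mk b).comp (measurable_fst.norm.prodMk (measurable_fst.sub measurable_snd).norm))
    ((mk _).comp (measurable_snd.norm.prodMk measurable_fst.norm))
    A1 A2 A3 _ (fun ξ => H1 _ (norm_nonneg _)) (fun ξ => ?_) (fun ξ => H3 _ (norm_nonneg _)) _ ?_
  · refine le_trans (le_of_eq ?_) (H2 ‖ξ‖ (norm_nonneg _))
    exact lintegral_sub_left_eq_self (fun ζ : Rd d => ENNReal.ofReal (kap d b ‖ξ‖ ‖ζ‖) ^ 2) ξ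
  · filter_upwards [hne 0] with ξ hξ
    rw [← lintegral_const_mul _ (by fun_prop)]
    apply lintegral_mono_ae
    filter_upwards [hne 0, hne ξ] with η h0 h1
    exact aux_pt d a b F G ξ η hξ h0 h1

theorem convIter_meas {X : Type*} [MeasurableSpace X] (d : ℕ) (g : X → Rd d → ℝ≥0∞)
    (hg : Measurable (fun q : X × Rd d => g q.1 q.2)) (n : ℕ) :
    Measurable (fun q : X × Rd d => convIter d (g q.1) n q.2) := by
  induction n with
  | zero => exact hg
  | succ n ih =>
    simp only [convIter]
    have : Measurable (fun r : (X × Rd d) × Rd d => g r.1.1 r.2 * convIter d (g r.1.1) n (r.1.2 - r.2)) := by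
      refine Measurable.mul ?_ ?_
      · exact hg.comp ((measurable_fst.comp measurable_fst).prodMk measurable_snd)
      · exact ih.comp ((measurable_fst.comp measurable_fst).prodMk
          ((measurable_snd.comp measurable_fst).sub measurable_snd))
    exact this.lintegral_prod_right'

theorem convIter_meas1 (d : ℕ) (g : Rd d → ℝ≥0∞) (hg : Measurable g) (n : ℕ) :
    Measurable (convIter d g n) :=
  (convIter_meas (X := Unit) d (fun _ => g) (hg.comp measurable_snd) n).comp
    (measurable_prodMk_left (x := ()))

theorem aux_convIter (d : ℕ) (hd : 1 ≤ d) (σ : ℝ) (hσ : 0 < σ) (n : ℕ) :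
    ((n:ℝ) + 1) * σ < d → ∃ C : ℝ≥0∞, C ≠ ⊤ ∧ ∀ g : Rd d → ℝ≥0∞, Measurable g →
      ∫⁻ ξ : Rd d, (wt d ((d:ℝ)/2 - ((n:ℝ)+1) * σ) ξ * convIter d g n ξ) ^ 2 ≤
        C * (∫⁻ ξ, (wt d ((d:ℝ)/2 - σ) ξ * g ξ) ^ 2) ^ (n + 1) := by
  induction n with
  | zero =>
    intro _
    exact ⟨1, by simp, fun g _ => by simp [convIter]⟩
  | succ n ih =>
    intro h
    push_cast at h
    obtain ⟨C, hC, H⟩ := ih (by nlinarith)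
    obtain ⟨C', hC', H'⟩ := aux_conv2 d hd σ (((n:ℝ)+1) * σ) hσ (by positivity) (by linarith)
    refine ⟨C' * C, ENNReal.mul_ne_top hC' hC, fun g hg => ?_⟩
    have e : (((n+1:ℕ):ℝ) + 1) * σ = σ + ((n:ℝ)+1) * σ := by push_cast; ring
    rw [e]
    refine (H' g (convIter d g n) hg (convIter_meas1 d g hg n)).trans ?_
    calc _ ≤ C' * ((∫⁻ ξ, (wt d ((d:ℝ)/2 - σ) ξ * g ξ) ^ 2) * (C * (∫⁻ ξ, (wt d ((d:ℝ)/2 - σ) ξ * g ξ) ^ 2) ^ (n + 1))) := by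
          gcongr; exact H g hg
      _ = _ := by ring

theorem convIter_exp (d : ℕ) (A c : ℝ) (hA : 0 ≤ A) (hc : 0 ≤ c) (g h : Rd d → ℝ≥0∞)
    (hh : Measurable h)
    (H : ∀ η, g η ≤ ENNReal.ofReal (A * Real.exp (-(c * ‖η‖))) * h η) (n : ℕ) (ξ : Rd d) :
    convIter d g n ξ ≤ ENNReal.ofReal (A ^ (n+1) * Real.exp (-(c * ‖ξ‖))) * convIter d h n ξ := by
  induction n generalizing ξ with
  | zero => simpa [convIter] using H ξ
  | succ n ih =>
    simp only [convIter]
    rw [← lintegral_const_mul]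
    swap
    · exact hh.mul ((convIter_meas1 d h hh n).comp (measurable_const.sub measurable_id))
    apply lintegral_mono
    intro η
    calc _ ≤ (ENNReal.ofReal (A * Real.exp (-(c * ‖η‖))) * h η) *
          (ENNReal.ofReal (A ^ (n+1) * Real.exp (-(c * ‖ξ - η‖))) * convIter d h n (ξ - η)) := by
          exact mul_le_mul' (H η) (ih _)
      _ = ENNReal.ofReal ((A * Real.exp (-(c * ‖η‖))) * (A ^ (n+1) * Real.exp (-(c * ‖ξ - η‖)))) *
          (h η * convIter d h n (ξ - η)) := by
          rw [ENNReal.ofReal_mul (p := A * Real.exp (-(c * ‖η‖))) (by positivity)]; ring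
      _ ≤ _ := by
          refine mul_le_mul' (ENNReal.ofReal_le_ofReal ?_) le_rfl
          have t3 : ‖ξ‖ ≤ ‖η‖ + ‖ξ - η‖ := by
            have := norm_add_le η (ξ - η); rwa [add_sub_cancel] at this
          calc _ = A ^ (n+1+1) * (Real.exp (-(c * ‖η‖)) * Real.exp (-(c * ‖ξ - η‖))) := by ring
            _ = A ^ (n+1+1) * Real.exp (-(c * (‖η‖ + ‖ξ - η‖))) := by
                rw [← Real.exp_add]; congr 2; ring
            _ ≤ _ := by gcongr

theorem aux_beta (θ γ : ℝ) (hθ : 0 ≤ θ) (hθ1 : θ < 1) (hγ : 0 ≤ γ) (hγ1 : γ < 1) :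
    ∃ B : ℝ, 0 ≤ B ∧ ∀ t : ℝ, 0 < t →
      ∫⁻ u in Set.Ioo (0:ℝ) t, ENNReal.ofReal ((t - u) ^ (-θ) * u ^ (-γ)) ≤
        ENNReal.ofReal (B * t ^ (1 - θ - γ)) := by
  have i1 : 0 < 1 - γ := by linarith
  have i2 : 0 < 1 - θ := by linarith
  refine ⟨(1/2) ^ (-θ) / (1 - γ) + (1/2) ^ (-γ) / (1 - θ), by positivity, fun t ht => ?_⟩
  have pt : ∀ u ∈ Set.Ioo (0:ℝ) t, ENNReal.ofReal ((t - u) ^ (-θ) * u ^ (-γ)) ≤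
      ENNReal.ofReal ((t/2) ^ (-θ)) * ENNReal.ofReal (u ^ (-γ)) +
      ENNReal.ofReal ((t/2) ^ (-γ)) * ENNReal.ofReal ((t - u) ^ (-θ)) := by
    intro u hu
    have h0 : 0 < u := hu.1
    have h1 : 0 < t - u := by linarith [hu.2]
    rw [← ENNReal.ofReal_mul (by positivity), ← ENNReal.ofReal_mul (by positivity),
      ← ENNReal.ofReal_add (by positivity) (by positivity)]
    apply ENNReal.ofReal_le_ofReal
    rcases le_total u (t/2) with h | h
    · have : (t - u) ^ (-θ) ≤ (t/2) ^ (-θ) :=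
        Real.rpow_le_rpow_of_nonpos (by positivity) (by linarith) (by linarith)
      calc _ ≤ (t/2) ^ (-θ) * u ^ (-γ) := by gcongr
        _ ≤ _ := le_add_of_nonneg_right (by positivity)
    · have : u ^ (-γ) ≤ (t/2) ^ (-γ) :=
        Real.rpow_le_rpow_of_nonpos (by positivity) (by linarith) (by linarith)
      calc _ ≤ (t - u) ^ (-θ) * (t/2) ^ (-γ) := by gcongr
        _ = (t/2) ^ (-γ) * (t - u) ^ (-θ) := by ring
        _ ≤ _ := le_add_of_nonneg_left (by positivity)
  have e0 : ∀ r : ℝ, -1 < r → ∫⁻ u in Set.Ioo (0:ℝ) t, ENNReal.ofReal (u ^ r) =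
      ENNReal.ofReal (t ^ (r+1) / (r+1)) := by
    intro r hr
    rw [setLIntegral_congr Ioo_ae_eq_Ioc, aux_pw r t hr ht.le]
  have e1 : ∀ r : ℝ, -1 < r → ∫⁻ u in Set.Ioo (0:ℝ) t, ENNReal.ofReal ((t - u) ^ r) =
      ENNReal.ofReal (t ^ (r+1) / (r+1)) := by
    intro r hr
    rw [← e0 r hr, ← lintegral_indicator measurableSet_Ioo, ← lintegral_indicator measurableSet_Ioo,
      ← lintegral_sub_left_eq_self _ t]
    congr 1
    funext u
    simp only [Set.indicator, Set.mem_Ioo, sub_pos, sub_lt_self_iff, sub_sub_cancel]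
    simp only [and_comm]
  calc _ ≤ ∫⁻ u in Set.Ioo (0:ℝ) t, (ENNReal.ofReal ((t/2) ^ (-θ)) * ENNReal.ofReal (u ^ (-γ)) +
      ENNReal.ofReal ((t/2) ^ (-γ)) * ENNReal.ofReal ((t - u) ^ (-θ))) :=
        setLIntegral_mono' measurableSet_Ioo pt
    _ = ENNReal.ofReal ((t/2) ^ (-θ)) * ENNReal.ofReal (t ^ (-γ+1) / (-γ+1)) +
      ENNReal.ofReal ((t/2) ^ (-γ)) * ENNReal.ofReal (t ^ (-θ+1) / (-θ+1)) := by
        rw [lintegral_add_left (by fun_prop), lintegral_const_mul _ (by fun_prop),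
          lintegral_const_mul _ (by fun_prop), e0 _ (by linarith), e1 _ (by linarith)]
    _ ≤ _ := by
        have j1 : 0 < -γ + 1 := by linarith
        have j2 : 0 < -θ + 1 := by linarith
        rw [← ENNReal.ofReal_mul (by positivity), ← ENNReal.ofReal_mul (by positivity),
          ← ENNReal.ofReal_add (by positivity) (by positivity)]
        apply ENNReal.ofReal_le_ofReal
        apply le_of_eq
        have k1 : t ^ (1 - θ - γ) = t ^ (-θ) * t ^ (-γ+1) := by
          rw [← Real.rpow_add ht]; congr 1; ring
        have k2 : t ^ (1 - θ - γ) = t ^ (-γ) * t ^ (-θ+1) := by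
          rw [← Real.rpow_add ht]; congr 1; ring
        rw [add_mul]
        congr 1
        · rw [k1, show t/2 = (1/2) * t by ring, Real.mul_rpow (by norm_num) ht.le,
            show -γ + 1 = 1 - γ by ring]
          ring
        · rw [k2, show t/2 = (1/2) * t by ring, Real.mul_rpow (by norm_num) ht.le,
            show -θ + 1 = 1 - θ by ring]
          ring

theorem aux_heat (ε θ x τ : ℝ) (hε : 0 < ε) (hθ : 0 ≤ θ) (hθ1 : θ ≤ 1) (hx : 0 < x) (hτ : 0 < τ) :
    x ^ (2 * θ) * Real.exp (-(ε * τ * x ^ 2)) ≤ (1 + 1/ε) * τ ^ (-θ) := by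
  have e1 : x ^ (2 * θ) = (τ * x ^ 2) ^ θ * τ ^ (-θ) := by
    rw [Real.mul_rpow hτ.le (by positivity), Real.rpow_mul hx.le, Real.rpow_neg hτ.le]
    have : τ ^ θ ≠ 0 := by positivity
    rw [show x ^ (2:ℝ) = x ^ 2 from Real.rpow_two x]
    field_simp
  have hu : 0 ≤ τ * x ^ 2 := by positivity
  have e2 : ε * τ * x ^ 2 = ε * (τ * x ^ 2) := by ring
  rw [e1, e2]
  generalize τ * x ^ 2 = u at hu
  have h1 : u ^ θ ≤ 1 + u := by
    rcases le_total u 1 with h | h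
    · have := Real.rpow_le_one hu h hθ; linarith
    · have := Real.rpow_le_rpow_of_exponent_le h hθ1
      rw [Real.rpow_one] at this; linarith
  have h2 : u ≤ 1/ε * Real.exp (ε * u) := by
    have := Real.add_one_le_exp (ε * u)
    have h3 : u = 1/ε * (ε * u) := by field_simp
    calc u = 1/ε * (ε * u) := h3
      _ ≤ _ := by gcongr; linarith
  have h4 : (1:ℝ) ≤ Real.exp (ε * u) := Real.one_le_exp (by positivity)
  have h5 : u ^ θ * Real.exp (-(ε * u)) ≤ 1 + 1/ε := by
    rw [Real.exp_neg, ← div_eq_mul_inv, div_le_iff₀ (Real.exp_pos _)]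
    nlinarith
  calc _ = (u ^ θ * Real.exp (-(ε * u))) * τ ^ (-θ) := by ring
    _ ≤ _ := by gcongr

theorem aux_time (d : ℕ) (ψ : ℝ → Rd d → ℝ≥0∞)
    (hψ : Measurable (fun q : ℝ × Rd d => ψ q.1 q.2)) (w : ℝ → ℝ≥0∞) (hw : Measurable w)
    (S : Set ℝ) (hS : MeasurableSet S) (A B : ℝ≥0∞)
    (hA : ∀ u ∈ S, ∫⁻ ξ, ψ u ξ ^ 2 ≤ A) (hB : ∫⁻ u in S, w u ≤ B) :
    ∫⁻ ξ, (∫⁻ u in S, w u * ψ u ξ) ^ 2 ≤ B ^ 2 * A := by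
  have hψ1 : ∀ ξ, Measurable (fun u => ψ u ξ) := fun ξ => hψ.comp measurable_prodMk_right
  have hψ2 : ∀ u, Measurable (fun ξ => ψ u ξ) := fun u => hψ.comp measurable_prodMk_left
  have sq : ∀ u, (w u ^ (1/2:ℝ)) ^ 2 = w u := by
    intro u
    rw [← ENNReal.rpow_natCast, ← ENNReal.rpow_mul]; norm_num
  have pt : ∀ ξ, (∫⁻ u in S, w u * ψ u ξ) ^ 2 ≤ B * ∫⁻ u in S, w u * ψ u ξ ^ 2 := by
    intro ξ
    have h := aux_cs (volume.restrict S) (fun u => w u ^ (1/2:ℝ)) (fun u => w u ^ (1/2:ℝ) * ψ u ξ)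
      (hw.pow_const _).aemeasurable ((hw.pow_const _).mul (hψ1 ξ)).aemeasurable
    have e : ∀ u, w u ^ (1/2:ℝ) * (w u ^ (1/2:ℝ) * ψ u ξ) = w u * ψ u ξ := fun u => by
      rw [← mul_assoc, ← pow_two, sq]
    simp only [e, mul_pow, sq] at h
    exact h.trans (mul_le_mul' hB le_rfl)
  have mm : Measurable (fun q : Rd d × ℝ => w q.2 * ψ q.2 q.1 ^ 2) :=
    (hw.comp measurable_snd).mul ((hψ.comp measurable_swap).pow_const 2)
  calc _ ≤ ∫⁻ ξ, B * ∫⁻ u in S, w u * ψ u ξ ^ 2 := lintegral_mono pt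
    _ = B * ∫⁻ ξ, ∫⁻ u in S, w u * ψ u ξ ^ 2 := by
        rw [lintegral_const_mul _ mm.lintegral_prod_right']
    _ = B * ∫⁻ u in S, ∫⁻ ξ, w u * ψ u ξ ^ 2 := by
        rw [lintegral_lintegral_swap mm.aemeasurable]
    _ ≤ B * ∫⁻ u in S, w u * A := by
        refine mul_le_mul' le_rfl (setLIntegral_mono' hS fun u hu => ?_)
        rw [lintegral_const_mul _ ((hψ2 u).pow_const 2)]
        exact mul_le_mul' le_rfl (hA u hu)
    _ ≤ B * (B * A) := by
        rw [lintegral_mul_const _ hw]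
        exact mul_le_mul' le_rfl (mul_le_mul' hB le_rfl)
    _ = _ := by ring

theorem aux_quad (ε b x : ℝ) (hε : ε < 1) : b * x - b ^ 2 / (4 * (1 - ε)) - (1 - ε) * x ^ 2 ≤ 0 := by
  have h : 0 < 1 - ε := by linarith
  have : b * x - b ^ 2 / (4 * (1 - ε)) - (1 - ε) * x ^ 2 =
      -((1 - ε) * (x - b / (2 * (1 - ε))) ^ 2) := by field_simp; ring
  rw [this]
  have := mul_nonneg h.le (sq_nonneg (x - b / (2 * (1 - ε))))
  linarith

theorem normU_meas {X : Type*} [MeasurableSpace X] (N : ℕ) (V : X → CN N)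
    (h : ∀ j : Fin N, Measurable fun q => V q j) : Measurable (fun q => ‖V q‖) := by
  simp only [EuclideanSpace.norm_eq]
  apply Measurable.sqrt
  exact Finset.measurable_sum _ fun j _ => (h j).norm.pow_const 2

theorem gev_meas (d N : ℕ) (ε lam T : ℝ) (U : ℝ → Rd d → CN N)
    (h : ∀ j : Fin N, Measurable fun q : ℝ × Rd d => U q.1 q.2 j) :
    Measurable (fun q : ℝ × Rd d => ENNReal.ofReal (gevreyHat d N ε lam T U q.1 q.2)) := by
  have hU := normU_meas N (fun q : ℝ × Rd d => U q.1 q.2) h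
  unfold gevreyHat
  apply Measurable.ennreal_ofReal
  refine Measurable.mul ?_ hU
  fun_prop

theorem aux_gev (d N K : ℕ) (β ε C₀ lam T : ℝ) (hε : ε < 1) (hlam : 0 < lam) (hT : 0 < T)
    (U₀ : Rd d → CN N) (U : ℝ → Rd d → CN N)
    (hU : ∀ j : Fin N, Measurable fun q : ℝ × Rd d => U q.1 q.2 j)
    (hDu : DuhamelIneq d N (K + 1) β C₀ T U₀ U) (t : ℝ) (ht : t ∈ Set.Ioc (0:ℝ) T) (ξ : Rd d) :
    ENNReal.ofReal (gevreyHat d N ε lam T U t ξ) ≤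
      ENNReal.ofReal ‖heatHat d N (ε * t) U₀ ξ‖ +
      ENNReal.ofReal C₀ * ENNReal.ofReal (Real.exp (lam ^ 2 / (4 * (1 - ε)))) ^ K *
        ∫⁻ u in Set.Ioc (0:ℝ) t, ENNReal.ofReal (Real.exp (-(ε * (t - u) * ‖ξ‖ ^ 2)) * ‖ξ‖ ^ β) *
          convIter d (fun η => ENNReal.ofReal (gevreyHat d N ε lam T U u η)) K ξ := by
  have h1e : 0 < 1 - ε := by linarith
  have hsT : 0 < Real.sqrt T := Real.sqrt_pos.2 hT
  obtain ⟨b, hb⟩ : ∃ b, b = lam / Real.sqrt T := ⟨_, rfl⟩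
  obtain ⟨a, ha⟩ : ∃ a, a = b ^ 2 / (4 * (1 - ε)) := ⟨_, rfl⟩
  have hb0 : 0 < b := by rw [hb]; positivity
  have ha0 : 0 ≤ a := by rw [ha]; positivity
  have hb2 : b ^ 2 = lam ^ 2 / T := by rw [hb, div_pow, Real.sq_sqrt hT.le]
  have haT : lam ^ 2 / (4 * (1 - ε)) = a * T := by
    rw [ha, hb2]; field_simp
  have hgev : ∀ u η, gevreyHat d N ε lam T U u η = Real.exp (-(a * u) + b * u * ‖η‖) * ‖U u η‖ := by
    intro u η
    unfold gevreyHat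
    congr 2
    rw [ha, hb2, hb]
    field_simp
  have hq : ∀ x : ℝ, -a + b * x - x ^ 2 ≤ -(ε * x ^ 2) := by
    intro x
    have := aux_quad ε b x hε
    rw [← ha] at this
    linarith
  rw [hgev, ENNReal.ofReal_mul (by positivity)]
  refine (mul_le_mul' le_rfl (hDu t ht ξ)).trans ?_
  rw [mul_add]
  refine add_le_add ?_ ?_
  · rw [← ENNReal.ofReal_mul (by positivity)]
    apply ENNReal.ofReal_le_ofReal
    unfold heatHat
    rw [norm_smul, ← mul_assoc, Real.norm_of_nonneg (Real.exp_pos _).le, ← Real.exp_add]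
    gcongr
    have := mul_le_mul_of_nonneg_left (hq ‖ξ‖) ht.1.le
    linarith
  · rw [haT, mul_left_comm, mul_assoc (ENNReal.ofReal C₀)]
    refine mul_le_mul' le_rfl ?_
    rw [← lintegral_const_mul' _ _ ENNReal.ofReal_ne_top,
      ← lintegral_const_mul' _ _ (ENNReal.pow_ne_top ENNReal.ofReal_ne_top)]
    refine setLIntegral_mono' measurableSet_Ioc fun u hu => ?_
    have hg := gev_meas d N ε lam T U hU
    have hg1 : Measurable (fun η => ENNReal.ofReal (gevreyHat d N ε lam T U u η)) :=
      hg.comp measurable_prodMk_left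
    have hu0 : 0 < u := hu.1
    have hc := convIter_exp d (Real.exp (a * u)) (b * u) (by positivity) (by positivity)
      (fun η => ENNReal.ofReal ‖U u η‖) (fun η => ENNReal.ofReal (gevreyHat d N ε lam T U u η)) hg1
      (by
        intro η
        rw [← ENNReal.ofReal_mul (by positivity)]
        apply ENNReal.ofReal_le_ofReal
        rw [hgev, ← mul_assoc, mul_assoc (Real.exp (a*u)), ← Real.exp_add, ← Real.exp_add]
        apply le_of_eq
        rw [show a * u + (-(b * u * ‖η‖) + (-(a * u) + b * u * ‖η‖)) = 0 by ring]
        simp) K ξ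
    rw [Nat.add_sub_cancel]
    refine (mul_le_mul' le_rfl (mul_le_mul' le_rfl hc)).trans ?_
    rw [← ENNReal.ofReal_pow (by positivity)]
    simp only [← mul_assoc]
    refine mul_le_mul' ?_ le_rfl
    rw [← ENNReal.ofReal_mul (by positivity), ← ENNReal.ofReal_mul (by positivity),
      ← ENNReal.ofReal_mul (by positivity)]
    apply ENNReal.ofReal_le_ofReal
    rw [← Real.exp_nat_mul, ← Real.exp_nat_mul]
    have key : (-(a * t) + b * t * ‖ξ‖) + -((t - u) * ‖ξ‖ ^ 2) + (((K+1:ℕ):ℝ) * (a * u) + -(b * u * ‖ξ‖))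
        ≤ K * (a * T) + -(ε * (t - u) * ‖ξ‖ ^ 2) := by
      have h1 := mul_le_mul_of_nonneg_left (hq ‖ξ‖) (show 0 ≤ t - u by linarith [hu.2])
      have h2 : (K:ℝ) * (a * u) ≤ K * (a * T) := by
        have : u ≤ T := hu.2.trans ht.2
        gcongr
      push_cast
      linarith
    calc _ = Real.exp ((-(a * t) + b * t * ‖ξ‖) + -((t - u) * ‖ξ‖ ^ 2) + (((K+1:ℕ):ℝ) * (a * u) + -(b * u * ‖ξ‖))) * ‖ξ‖ ^ β := by
          simp only [Real.exp_add]; ring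
      _ ≤ Real.exp (K * (a * T) + -(ε * (t - u) * ‖ξ‖ ^ 2)) * ‖ξ‖ ^ β := by gcongr
      _ = _ := by rw [Real.exp_add]; ring

theorem hSobR_eq (d : ℕ) (s : ℝ) (g : Rd d → ℝ) (hg : ∀ ξ, 0 ≤ g ξ) :
    hSobR d s g = (∫⁻ ξ, (wt d s ξ * ENNReal.ofReal (g ξ)) ^ 2) ^ (1/2:ℝ) := by
  unfold hSobR wt
  congr 2
  funext ξ
  rw [← ENNReal.ofReal_mul (by positivity), ← ENNReal.ofReal_pow (mul_nonneg (by positivity) (hg ξ))]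
  rw [mul_pow, mul_comm 2 s, Real.rpow_mul (norm_nonneg _), Real.rpow_two]

theorem hSob_eq (d N : ℕ) (s : ℝ) (g : Rd d → CN N) :
    hSob d N s g = (∫⁻ ξ, (wt d s ξ * ENNReal.ofReal ‖g ξ‖) ^ 2) ^ (1/2:ℝ) :=
  hSobR_eq d s (fun ξ => ‖g ξ‖) (fun _ => norm_nonneg _)

theorem en_sqrt_sq (x : ℝ≥0∞) : (x ^ 2) ^ (1/2:ℝ) = x := by
  rw [← ENNReal.rpow_natCast, ← ENNReal.rpow_mul]; norm_num

theorem en_sq_sqrt (x : ℝ≥0∞) : (x ^ (1/2:ℝ)) ^ 2 = x := by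
  rw [← ENNReal.rpow_natCast, ← ENNReal.rpow_mul]; norm_num

theorem aux_L2add (d : ℕ) (f g h : Rd d → ℝ≥0∞) (hg : Measurable g) (hh : Measurable h)
    (H : ∀ᵐ ξ, f ξ ≤ g ξ + h ξ) (Q : ℝ≥0∞) (hQ : ∫⁻ ξ, h ξ ^ 2 ≤ Q ^ 2) :
    (∫⁻ ξ, f ξ ^ 2) ^ (1/2:ℝ) ≤ (∫⁻ ξ, g ξ ^ 2) ^ (1/2:ℝ) + Q := by
  have h1 := ENNReal.lintegral_Lp_add_le (μ := (volume : Measure (Rd d))) (p := 2)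
    hg.aemeasurable hh.aemeasurable (by norm_num)
  simp only [Pi.add_apply, ENNReal.rpow_two] at h1
  calc _ ≤ (∫⁻ ξ, (g ξ + h ξ) ^ 2) ^ (1/2:ℝ) := by
        refine ENNReal.rpow_le_rpow (lintegral_mono_ae ?_) (by norm_num)
        filter_upwards [H] with ξ hξ
        exact pow_le_pow_left' hξ 2
    _ ≤ _ := h1
    _ ≤ _ := by
        refine add_le_add le_rfl ?_
        calc _ ≤ (Q ^ 2) ^ (1/2:ℝ) := ENNReal.rpow_le_rpow hQ (by norm_num)
          _ = Q := en_sqrt_sq Q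

theorem aux_mult (d K : ℕ) (β α ε p σ s θ : ℝ) (hK : 1 ≤ K)
    (hα : α = (2 - β) / K) (hs : s = (d:ℝ)/2 - σ) (hσ : σ = α - 2/p) (hθ : θ = 1 - K/p)
    (hθ0 : 0 ≤ θ) (hθ1 : θ ≤ 1)
    (hε : 0 < ε) (τ : ℝ) (hτ : 0 < τ) (x : ℝ) (hx : 0 < x) :
    x ^ s * (Real.exp (-(ε * τ * x ^ 2)) * x ^ β) ≤
      (1 + 1/ε) * τ ^ (-θ) * x ^ ((d:ℝ)/2 - ((K:ℝ)+1) * σ) := by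
  have hK0 : (K:ℝ) ≠ 0 := by positivity
  have e : s + β = 2 * θ + ((d:ℝ)/2 - ((K:ℝ)+1) * σ) := by
    have : (K:ℝ) * α = 2 - β := by rw [hα]; field_simp
    rw [hs, hθ, hσ]
    linear_combination this
  calc _ = x ^ (s + β) * Real.exp (-(ε * τ * x ^ 2)) := by rw [Real.rpow_add hx]; ring
    _ = (x ^ (2 * θ) * Real.exp (-(ε * τ * x ^ 2))) * x ^ ((d:ℝ)/2 - ((K:ℝ)+1) * σ) := by
        rw [e, Real.rpow_add hx]; ring
    _ ≤ _ := by
        exact mul_le_mul_of_nonneg_right (aux_heat ε θ x τ hε hθ0 hθ1 hx hτ) (by positivity)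

theorem aux_fixed (d N K : ℕ) (hd : 1 ≤ d) (hK : 1 ≤ K)
    (β α ε p C₀ σ s θ γ B : ℝ) (hα : α = (2 - β) / K) (hε : ε ∈ Set.Ioo (0:ℝ) 1)
    (hs : s = (d:ℝ)/2 - σ) (hσ : σ = α - 2/p) (hp : 0 < p)
    (hθ : θ = 1 - K/p) (hγ : γ = ((K:ℝ) + 1)/p) (hθ0 : 0 ≤ θ) (hθ1 : θ ≤ 1)
    (hB : ∀ t : ℝ, 0 < t →
      ∫⁻ u in Set.Ioo (0:ℝ) t, ENNReal.ofReal ((t - u) ^ (-θ) * u ^ (-γ)) ≤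
        ENNReal.ofReal (B * t ^ (1 - θ - γ))) (hB0 : 0 ≤ B)
    (Cc : ℝ≥0∞) (hCc : ∀ g : Rd d → ℝ≥0∞, Measurable g →
      ∫⁻ ξ : Rd d, (wt d ((d:ℝ)/2 - ((K:ℝ)+1) * σ) ξ * convIter d g K ξ) ^ 2 ≤
        Cc * (∫⁻ ξ, (wt d ((d:ℝ)/2 - σ) ξ * g ξ) ^ 2) ^ (K + 1))
    (lam T : ℝ) (hlam : 0 < lam) (hT : 0 < T)
    (U₀ : Rd d → CN N) (U : ℝ → Rd d → CN N)
    (hU₀ : ∀ j : Fin N, Measurable fun ξ => U₀ ξ j)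
    (hU : ∀ j : Fin N, Measurable fun q : ℝ × Rd d => U q.1 q.2 j)
    (hDu : DuhamelIneq d N (K + 1) β C₀ T U₀ U) (M : ℝ≥0∞)
    (hM : ∀ u ∈ Set.Ioc (0:ℝ) T,
      ENNReal.ofReal (u ^ (1/p)) * hSobR d s (gevreyHat d N ε lam T U u) ≤ M)
    (t : ℝ) (ht : t ∈ Set.Ioc (0:ℝ) T) :
    ENNReal.ofReal (t ^ (1/p)) * hSobR d s (gevreyHat d N ε lam T U t) ≤
      ENNReal.ofReal (t ^ (1/p)) * hSob d N s (heatHat d N (ε * t) U₀) +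
        (ENNReal.ofReal C₀ * ENNReal.ofReal (1 + 1/ε) * ENNReal.ofReal B * Cc ^ (1/2:ℝ)) *
        (ENNReal.ofReal (Real.exp (lam ^ 2 / (4 * (1 - ε)))) ^ K * M ^ (K+1)) := by
  have : Nonempty (Fin d) := ⟨⟨0, hd⟩⟩
  have : Nontrivial (Rd d) := inferInstance
  have ht0 : 0 < t := ht.1
  have gnn : ∀ u ξ, 0 ≤ gevreyHat d N ε lam T U u ξ := by
    intro u ξ; unfold gevreyHat; positivity
  have hg := gev_meas d N ε lam T U hU
  have hgu : ∀ u, Measurable (fun η => ENNReal.ofReal (gevreyHat d N ε lam T U u η)) :=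
    fun u => hg.comp measurable_prodMk_left
  have hdu := aux_gev d N K β ε C₀ lam T hε.2 hlam hT U₀ U hU hDu t ht
  simp only [hSobR_eq d s _ (gnn _)] at hM ⊢
  rw [hSob_eq]
  obtain ⟨g, hgdef⟩ : ∃ g : ℝ → Rd d → ℝ≥0∞,
      g = fun u η => ENNReal.ofReal (gevreyHat d N ε lam T U u η) := ⟨_, rfl⟩
  have hg' : Measurable (fun q : ℝ × Rd d => g q.1 q.2) := by rw [hgdef]; exact hg
  have hgu' : ∀ u, Measurable (g u) := by rw [hgdef]; exact hgu
  have hge : ∀ u η, ENNReal.ofReal (gevreyHat d N ε lam T U u η) = g u η := by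
    intro u η; rw [hgdef]
  simp only [hge] at hM hdu ⊢
  change ∀ ξ : Rd d, g t ξ ≤ ENNReal.ofReal ‖heatHat d N (ε * t) U₀ ξ‖ +
      ENNReal.ofReal C₀ * ENNReal.ofReal (Real.exp (lam ^ 2 / (4 * (1 - ε)))) ^ K *
        ∫⁻ u in Set.Ioc (0:ℝ) t, ENNReal.ofReal (Real.exp (-(ε * (t - u) * ‖ξ‖ ^ 2)) * ‖ξ‖ ^ β) *
          convIter d (g u) K ξ at hdu
  generalize ENNReal.ofReal (Real.exp (lam ^ 2 / (4 * (1 - ε)))) ^ K = E at *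
  -- the functions psi and w
  obtain ⟨ψ, hψ⟩ : ∃ ψ : ℝ → Rd d → ℝ≥0∞, ψ = fun u ξ => ENNReal.ofReal (u ^ γ) *
    (wt d ((d:ℝ)/2 - ((K:ℝ)+1) * σ) ξ * convIter d (g u) K ξ) := ⟨_, rfl⟩
  obtain ⟨w, hw⟩ : ∃ w : ℝ → ℝ≥0∞, w = fun u => ENNReal.ofReal ((t - u) ^ (-θ) * u ^ (-γ)) :=
    ⟨_, rfl⟩
  have mw : Measurable w := by rw [hw]; fun_prop
  have mconv := convIter_meas d g hg' K
  have mψ : Measurable (fun q : ℝ × Rd d => ψ q.1 q.2) := by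
    rw [hψ]
    refine Measurable.mul (by fun_prop) (Measurable.mul ?_ mconv)
    exact (wt_meas d _).comp measurable_snd
  have hψA : ∀ u ∈ Set.Ioo (0:ℝ) t, ∫⁻ ξ, ψ u ξ ^ 2 ≤ Cc * (M ^ 2) ^ (K+1) := by
    intro u hu
    have hu0 : 0 < u := hu.1
    have h1 := pow_le_pow_left' (hM u ⟨hu.1, hu.2.le.trans ht.2⟩) 2
    rw [mul_pow, en_sq_sqrt] at h1
    have h2 : ENNReal.ofReal (u ^ γ) = ENNReal.ofReal (u ^ (1/p)) ^ (K+1) := by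
      rw [← ENNReal.ofReal_pow (by positivity), ← Real.rpow_natCast, ← Real.rpow_mul hu0.le, hγ]
      congr 2; push_cast; ring
    rw [hψ]
    simp only [mul_pow (ENNReal.ofReal (u ^ γ))]
    rw [lintegral_const_mul' _ _ (ENNReal.pow_ne_top ENNReal.ofReal_ne_top), h2]
    calc _ ≤ (ENNReal.ofReal (u ^ (1/p)) ^ (K+1)) ^ 2 *
          (Cc * (∫⁻ ξ, (wt d s ξ * g u ξ) ^ 2) ^ (K + 1)) := by
          rw [hs]; exact mul_le_mul' le_rfl (hCc _ (hgu' u))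
      _ = Cc * (ENNReal.ofReal (u ^ (1/p)) ^ 2 * (∫⁻ ξ, (wt d s ξ * g u ξ) ^ 2)) ^ (K+1) := by
          rw [mul_pow, ← pow_mul, ← pow_mul, mul_comm 2 (K+1)]; ring
      _ ≤ _ := mul_le_mul' le_rfl (pow_le_pow_left' h1 _)
  have hwB : ∫⁻ u in Set.Ioo (0:ℝ) t, w u ≤ ENNReal.ofReal (B * t ^ (1 - θ - γ)) := by
    rw [hw]; exact hB t ht0
  have hT2 := aux_time d ψ mψ w mw _ measurableSet_Ioo _ _ hψA hwB
  have hexp : 1 - θ - γ = -(1/p) := by rw [hθ, hγ]; ring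
  rw [hexp] at hT2
  obtain ⟨R, hR⟩ : ∃ R, R = ENNReal.ofReal C₀ * E * ENNReal.ofReal (1 + 1/ε) := ⟨_, rfl⟩
  have mJ : Measurable (fun ξ => ∫⁻ u in Set.Ioo (0:ℝ) t, w u * ψ u ξ) := by
    have mm : Measurable (fun q : Rd d × ℝ => w q.2 * ψ q.2 q.1) :=
      (mw.comp measurable_snd).mul (mψ.comp measurable_swap)
    exact mm.lintegral_prod_right'
  have hε1 : 0 < 1 + 1/ε := by have := hε.1; positivity
  have hpt : ∀ᵐ ξ : Rd d, wt d s ξ * g t ξ ≤ wt d s ξ * ENNReal.ofReal ‖heatHat d N (ε * t) U₀ ξ‖ +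
      R * ∫⁻ u in Set.Ioo (0:ℝ) t, w u * ψ u ξ := by
    have hne : ∀ᵐ η : Rd d, η ≠ 0 := by simp [ae_iff]
    filter_upwards [hne] with ξ hξ
    have hx : 0 < ‖ξ‖ := norm_pos_iff.2 hξ
    refine (mul_le_mul' le_rfl (hdu ξ)).trans ?_
    rw [mul_add]
    refine add_le_add le_rfl ?_
    rw [hR, mul_left_comm, mul_assoc (ENNReal.ofReal C₀ * E)]
    refine mul_le_mul' le_rfl ?_
    rw [← setLIntegral_congr Ioo_ae_eq_Ioc, ← lintegral_const_mul' _ _ ENNReal.ofReal_ne_top]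
    rw [wt, ← lintegral_const_mul' _ _ ENNReal.ofReal_ne_top]
    refine setLIntegral_mono' measurableSet_Ioo fun u hu => ?_
    have hu0 : 0 < u := hu.1
    have htu : 0 < t - u := by linarith [hu.2]
    rw [hw, hψ]
    simp only [wt, ← mul_assoc]
    refine mul_le_mul' ?_ le_rfl
    rw [← ENNReal.ofReal_mul (by positivity), ← ENNReal.ofReal_mul (by positivity),
      ← ENNReal.ofReal_mul (by positivity), ← ENNReal.ofReal_mul (by positivity)]
    apply ENNReal.ofReal_le_ofReal
    refine (aux_mult d K β α ε p σ s θ hK hα hs hσ hθ hθ0 hθ1 hε.1 (t-u) htu ‖ξ‖ hx).trans ?_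
    apply le_of_eq
    have : u ^ (-γ) * u ^ γ = 1 := by rw [← Real.rpow_add hu0]; simp
    linear_combination (-(1 + 1/ε) * (t - u) ^ (-θ) * ‖ξ‖ ^ ((d:ℝ)/2 - ((K:ℝ)+1) * σ)) * this
  have mheat : Measurable (fun ξ => wt d s ξ * ENNReal.ofReal ‖heatHat d N (ε * t) U₀ ξ‖) := by
    refine (wt_meas d s).mul (Measurable.ennreal_ofReal ?_)
    unfold heatHat
    simp only [norm_smul]
    refine Measurable.mul (by fun_prop) (normU_meas N U₀ hU₀)
  have hfin := aux_L2add d _ _ _ mheat (mJ.const_mul R) hpt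
    (R * (ENNReal.ofReal (B * t ^ (-(1/p))) * Cc ^ (1/2:ℝ) * M ^ (K+1))) (by
      simp only [mul_pow R]
      rw [lintegral_const_mul _ (mJ.pow_const 2)]
      refine mul_le_mul' le_rfl (hT2.trans (le_of_eq ?_))
      rw [mul_pow, mul_pow, en_sq_sqrt, ← pow_mul, ← pow_mul, mul_comm 2 (K+1)]
      ring)
  refine (mul_le_mul' le_rfl hfin).trans ?_
  rw [mul_add]
  refine add_le_add le_rfl (le_of_eq ?_)
  have h1 : ENNReal.ofReal (t ^ (1/p)) * ENNReal.ofReal (t ^ (-(1/p))) = 1 := by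
    rw [← ENNReal.ofReal_mul (by positivity), ← Real.rpow_add ht0]; simp
  rw [ENNReal.ofReal_mul hB0, hR]
  calc _ = (ENNReal.ofReal (t ^ (1/p)) * ENNReal.ofReal (t ^ (-(1/p)))) *
        ((ENNReal.ofReal C₀ * ENNReal.ofReal (1 + 1/ε) * ENNReal.ofReal B * Cc ^ (1/2:ℝ)) *
        (E * M ^ (K+1))) := by ring
    _ = _ := by rw [h1, one_mul]

/-- Lemma 2.1, the key Gevrey estimate.  Let `k = K+1 ≥ 2`, `β ∈ [0,2)`,
`α = (2-β)/(k-1) ∈ (0, d/k]`, `s_crit = d/2-α`, `ε ∈ (0,1)`, `p ∈ (max(2/α,k),∞)` and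
`C₀ > 0`.  There is a constant `C = C_{k,ε} > 0` (independent of `λ`, `T`, `U`, `U₀`) such
that whenever `U` satisfies the Duhamel inequality on `(0,T]` with data `U₀` and constant
`C₀`, the Gevrey-weighted function `U_a` satisfies
`‖U_a‖_{K^p_T} ≤ ‖e^{εtΔ}U₀‖_{K^p_T} + C (e^{λ²/(4(1−ε))} ‖U_a‖_{K^p_T})^{k−1} ‖U_a‖_{K^p_T}`. -/
theorem statement5 (d N K : ℕ) (hd : 1 ≤ d) (hN : 1 ≤ N) (hK : 1 ≤ K)
    (β α scrit : ℝ) (hβ : β ∈ Set.Ico (0:ℝ) 2)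
    (hα : α = (2 - β) / K) (hscrit : scrit = (d:ℝ) / 2 - α)
    (hα_mem : α ∈ Set.Ioc (0:ℝ) ((d:ℝ) / ((K:ℝ) + 1)))
    (ε p C₀ : ℝ) (hε : ε ∈ Set.Ioo (0:ℝ) 1) (hp : max (2 / α) ((K:ℝ) + 1) < p)
    (hC₀ : 0 < C₀) :
    ∃ C > (0:ℝ), ∀ lam T : ℝ, 0 < lam → 0 < T →
      ∀ (U₀ : Rd d → CN N) (U : ℝ → Rd d → CN N),
        (∀ j : Fin N, Measurable fun ξ => U₀ ξ j) →
        (∀ j : Fin N, Measurable fun q : ℝ × Rd d => U q.1 q.2 j) →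
        DuhamelIneq d N (K + 1) β C₀ T U₀ U →
        katoR d scrit p T (gevreyHat d N ε lam T U) ≤
          heatKato d N ε scrit p T U₀ +
            ENNReal.ofReal C *
              (ENNReal.ofReal (Real.exp (lam ^ 2 / (4 * (1 - ε)))) *
                katoR d scrit p T (gevreyHat d N ε lam T U)) ^ K *
              katoR d scrit p T (gevreyHat d N ε lam T U) := by
  obtain ⟨hε0, hε1⟩ := hε
  obtain ⟨hα0, hαd⟩ := hα_mem
  have hp1 : 2 / α < p := lt_of_le_of_lt (le_max_left _ _) hp
  have hp2 : (K:ℝ) + 1 < p := lt_of_le_of_lt (le_max_right _ _) hp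
  have hK0 : (0:ℝ) < K := by exact_mod_cast hK
  have hp0 : 0 < p := by linarith
  have hσ0 : 0 < α - 2/p := by
    rw [div_lt_iff₀ hα0] at hp1
    rw [sub_pos, div_lt_iff₀ hp0]; linarith
  have hσd : ((K:ℝ) + 1) * (α - 2/p) < d := by
    rw [le_div_iff₀ (by positivity)] at hαd
    have : 0 < ((K:ℝ)+1) * (2/p) := by positivity
    linarith
  have hθ0 : 0 ≤ 1 - (K:ℝ)/p := by
    rw [sub_nonneg, div_le_one hp0]; linarith
  have hθ1 : 1 - (K:ℝ)/p < 1 := by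
    have : 0 < (K:ℝ)/p := by positivity
    linarith
  have hγ1 : ((K:ℝ)+1)/p < 1 := by rw [div_lt_one hp0]; exact hp2
  obtain ⟨B, hB0, hB⟩ := aux_beta (1 - (K:ℝ)/p) (((K:ℝ)+1)/p) hθ0 hθ1 (by positivity) hγ1
  obtain ⟨Cc, hCct, hCc⟩ := aux_convIter d hd (α - 2/p) hσ0 K hσd
  obtain ⟨Q, hQ⟩ : ∃ Q, Q = ENNReal.ofReal C₀ * ENNReal.ofReal (1 + 1/ε) * ENNReal.ofReal B *
    Cc ^ (1/2:ℝ) := ⟨_, rfl⟩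
  have hQt : Q ≠ ⊤ := by
    rw [hQ]
    refine ENNReal.mul_ne_top (ENNReal.mul_ne_top (ENNReal.mul_ne_top ENNReal.ofReal_ne_top
      ENNReal.ofReal_ne_top) ENNReal.ofReal_ne_top) ?_
    exact ENNReal.rpow_ne_top_of_nonneg (by norm_num) hCct
  refine ⟨Q.toReal + 1, by positivity, ?_⟩
  intro lam T hlam hT U₀ U hU₀ hU hDu
  have hQle : Q ≤ ENNReal.ofReal (Q.toReal + 1) := by
    calc Q = ENNReal.ofReal Q.toReal := (ENNReal.ofReal_toReal hQt).symm
      _ ≤ _ := ENNReal.ofReal_le_ofReal (by linarith)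
  obtain ⟨M, hM⟩ : ∃ M, M = katoR d scrit p T (gevreyHat d N ε lam T U) := ⟨_, rfl⟩
  have hMle : ∀ u ∈ Set.Ioc (0:ℝ) T,
      ENNReal.ofReal (u ^ (1/p)) * hSobR d (scrit + 2/p) (gevreyHat d N ε lam T U u) ≤ M := by
    intro u hu
    rw [hM]
    exact le_iSup₂ (f := fun (u : ℝ) (_ : u ∈ Set.Ioc (0:ℝ) T) => ENNReal.ofReal (u ^ (1/p)) *
      hSobR d (scrit + 2/p) (gevreyHat d N ε lam T U u)) u hu
  rw [← hM]
  conv_lhs => rw [hM]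
  refine iSup₂_le fun t ht => ?_
  have h := aux_fixed d N K hd hK β α ε p C₀ (α - 2/p) (scrit + 2/p) (1 - K/p) (((K:ℝ)+1)/p) B
    hα ⟨hε0, hε1⟩ (by rw [hscrit]; ring) rfl hp0 rfl rfl hθ0 hθ1.le hB hB0 Cc hCc lam T hlam hT
    U₀ U hU₀ hU hDu M hMle t ht
  rw [← hQ] at h
  refine h.trans (add_le_add ?_ ?_)
  · exact le_iSup₂ (f := fun (u : ℝ) (_ : u ∈ Set.Ioc (0:ℝ) T) => ENNReal.ofReal (u ^ (1/p)) *
      hSob d N (scrit + 2/p) (heatHat d N (ε * u) U₀)) t ht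
  · refine (mul_le_mul' hQle le_rfl).trans (le_of_eq ?_)
    rw [mul_pow, pow_succ]; ring

end
end

section
/- Let ε ∈ (0,1), λ > 0, T > 0. Suppose U satisfies the Duhamel inequality on (0,T] with data U₀ and constant C₀, and let U_a be the associated Gevrey-weighted function. Then for all t ∈ (0,T] and ξ ∈ ℝ^d: Û_a(t,ξ) ≤ e^{−εt|ξ|²} |Û₀(ξ)| + C₀ e^{λ²(k−1)/(4(1−ε))} ∫_0^t e^{−ε(t−t')|ξ|²} |ξ|^β ( Û_a(t') ⋆ ⋯ ⋆ Û_a(t') )(ξ) dt', where the convolution is k-fold. -/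
open MeasureTheory Real Filter Topology
open scoped ENNReal NNReal

noncomputable section

theorem convIter_weight (d : ℕ) (g : Rd d → ℝ) (hg : ∀ η, 0 ≤ g η) (p q : ℝ) (hq : 0 ≤ q)
    (n : ℕ) (ξ : Rd d) :
    ENNReal.ofReal (Real.exp (-(((n:ℝ) + 1) * p) + q * ‖ξ‖)) *
        convIter d (fun η => ENNReal.ofReal (g η)) n ξ ≤
      convIter d (fun η => ENNReal.ofReal (Real.exp (-p + q * ‖η‖) * g η)) n ξ := by
  induction n generalizing ξ with
  | zero =>
    simp only [convIter]
    rw [← ENNReal.ofReal_mul (Real.exp_nonneg _)]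
    simp
  | succ n ih =>
    simp only [convIter]
    rw [← lintegral_const_mul' _ _ ENNReal.ofReal_ne_top]
    apply lintegral_mono
    intro η
    have h1 : Real.exp (-((((n + 1 : ℕ):ℝ) + 1) * p) + q * ‖ξ‖) ≤
        Real.exp (-p + q * ‖η‖) * Real.exp (-(((n:ℝ) + 1) * p) + q * ‖ξ - η‖) := by
      rw [← Real.exp_add]
      apply Real.exp_le_exp.2
      have h2 : ‖ξ‖ ≤ ‖η‖ + ‖ξ - η‖ := by
        have := norm_add_le η (ξ - η)
        simpa using this
      have h3 := mul_le_mul_of_nonneg_left h2 hq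
      push_cast
      linarith
    calc _ ≤ ENNReal.ofReal (Real.exp (-p + q * ‖η‖) *
              Real.exp (-(((n:ℝ) + 1) * p) + q * ‖ξ - η‖)) *
            (ENNReal.ofReal (g η) * convIter d (fun η => ENNReal.ofReal (g η)) n (ξ - η)) :=
          mul_le_mul_left (ENNReal.ofReal_le_ofReal h1) _
      _ = ENNReal.ofReal (Real.exp (-p + q * ‖η‖) * g η) *
            (ENNReal.ofReal (Real.exp (-(((n:ℝ) + 1) * p) + q * ‖ξ - η‖)) *
              convIter d (fun η => ENNReal.ofReal (g η)) n (ξ - η)) := by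
          rw [ENNReal.ofReal_mul (Real.exp_nonneg _), ENNReal.ofReal_mul (Real.exp_nonneg _)]
          ring
      _ ≤ _ := mul_le_mul_right (ih (ξ - η)) _

theorem gevrey_exponent (ε a τ x : ℝ) (hε : ε < 1) (hτ : 0 ≤ τ) :
    -(a ^ 2 / (4 * (1 - ε)) * τ) + a * τ * x - τ * x ^ 2 ≤ -(ε * τ * x ^ 2) := by
  have h1 : 0 < 1 - ε := by linarith
  have h2 : 0 ≤ a ^ 2 / (4 * (1 - ε)) - a * x + (1 - ε) * x ^ 2 := by
    have : a ^ 2 / (4 * (1 - ε)) - a * x + (1 - ε) * x ^ 2 =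
        (a - 2 * (1 - ε) * x) ^ 2 / (4 * (1 - ε)) := by
      field_simp
      ring
    rw [this]
    positivity
  nlinarith [mul_nonneg hτ h2]

/-- inequality (2.3) in the paper.  Let `ε ∈ (0,1)`, `λ > 0`, `T > 0`.
If `U` satisfies the Duhamel inequality on `(0,T]` with data `U₀` and constant `C₀`, then
the Gevrey-weighted function satisfies, for every `t ∈ (0,T]` and `ξ`,
`Û_a(t,ξ) ≤ e^{−εt|ξ|²}|Û₀(ξ)| + C₀ e^{λ²(k−1)/(4(1−ε))} ∫₀ᵗ e^{−ε(t−t')|ξ|²} |ξ|^β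
(Û_a(t') ⋆ ⋯ ⋆ Û_a(t'))(ξ) dt'` (with a `k`-fold convolution). -/
theorem statement6 (d N k : ℕ) (hd : 1 ≤ d) (hN : 1 ≤ N) (hk : 2 ≤ k)
    (β : ℝ) (hβ : β ∈ Set.Ico (0:ℝ) 2)
    (ε lam T C₀ : ℝ) (hε : ε ∈ Set.Ioo (0:ℝ) 1) (hlam : 0 < lam) (hT : 0 < T)
    (hC₀ : 0 < C₀) (U₀ : Rd d → CN N) (U : ℝ → Rd d → CN N)
    (hDuh : DuhamelIneq d N k β C₀ T U₀ U) :
    ∀ t ∈ Set.Ioc (0:ℝ) T, ∀ ξ : Rd d,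
      ENNReal.ofReal (gevreyHat d N ε lam T U t ξ) ≤
        ENNReal.ofReal (Real.exp (-(ε * t * ‖ξ‖ ^ 2)) * ‖U₀ ξ‖) +
          ENNReal.ofReal (C₀ * Real.exp (lam ^ 2 * ((k:ℝ) - 1) / (4 * (1 - ε)))) *
            ∫⁻ t' in Set.Ioc (0:ℝ) t,
              ENNReal.ofReal (Real.exp (-(ε * (t - t') * ‖ξ‖ ^ 2)) * ‖ξ‖ ^ β) *
                convIter d (fun η => ENNReal.ofReal (gevreyHat d N ε lam T U t' η)) (k - 1) ξ := by
  intro t ht ξ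
  obtain ⟨hε0, hε1⟩ := hε
  have h1ε : 0 < 1 - ε := by linarith
  obtain ⟨a, ha⟩ : ∃ a, a = lam / Real.sqrt T := ⟨_, rfl⟩
  have ha0 : 0 ≤ a := by rw [ha]; positivity
  obtain ⟨c, hc⟩ : ∃ c, c = a ^ 2 / (4 * (1 - ε)) := ⟨_, rfl⟩
  have hc0 : 0 ≤ c := by rw [hc]; positivity
  have hcT : c * T = lam ^ 2 / (4 * (1 - ε)) := by
    rw [hc, ha, div_pow, Real.sq_sqrt hT.le]
    field_simp
  have hG : ∀ s η, gevreyHat d N ε lam T U s η =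
      Real.exp (-(c * s) + (a * s) * ‖η‖) * ‖U s η‖ := by
    intro s η
    unfold gevreyHat
    congr 2
    have : c = lam ^ 2 / (4 * (1 - ε)) / T := by rw [← hcT]; field_simp
    rw [this, ha]
    congr 1 <;> field_simp
  obtain ⟨n, rfl⟩ : ∃ n, k = n + 1 := ⟨k - 1, by omega⟩
  simp only [hG, Nat.add_sub_cancel]
  have hD := hDuh t ht ξ
  simp only [Nat.add_sub_cancel] at hD
  obtain ⟨W, hW⟩ : ∃ W, W = Real.exp (-(c * t) + (a * t) * ‖ξ‖) := ⟨_, rfl⟩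
  have hW0 : 0 ≤ W := by rw [hW]; positivity
  rw [← hW, ENNReal.ofReal_mul hW0]
  refine (mul_le_mul_right hD _).trans ?_
  rw [mul_add]
  refine add_le_add ?_ ?_
  · rw [← ENNReal.ofReal_mul hW0, ← mul_assoc, hW, ← Real.exp_add]
    apply ENNReal.ofReal_le_ofReal
    apply mul_le_mul_of_nonneg_right _ (norm_nonneg _)
    apply Real.exp_le_exp.2
    have := gevrey_exponent ε a t ‖ξ‖ hε1 ht.1.le
    rw [← hc] at this
    linarith
  · rw [ENNReal.ofReal_mul hC₀.le, mul_left_comm, mul_assoc]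
    refine mul_le_mul_right ?_ _
    rw [← lintegral_const_mul' _ _ ENNReal.ofReal_ne_top,
      ← lintegral_const_mul' _ _ ENNReal.ofReal_ne_top]
    apply setLIntegral_mono' measurableSet_Ioc
    intro s hs
    have hcv := convIter_weight d (fun η => ‖U s η‖) (fun η => norm_nonneg _) (c * s) (a * s)
      (mul_nonneg ha0 hs.1.le) n ξ
    have hk1 : W * (Real.exp (-((t - s) * ‖ξ‖ ^ 2)) * ‖ξ‖ ^ β) ≤
        Real.exp (lam ^ 2 * (((n + 1 : ℕ):ℝ) - 1) / (4 * (1 - ε))) *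
          (Real.exp (-(ε * (t - s) * ‖ξ‖ ^ 2)) * ‖ξ‖ ^ β) *
          Real.exp (-(((n:ℝ) + 1) * (c * s)) + a * s * ‖ξ‖) := by
      have hb : 0 ≤ ‖ξ‖ ^ β := Real.rpow_nonneg (norm_nonneg _) _
      have key : W * Real.exp (-((t - s) * ‖ξ‖ ^ 2)) ≤
          Real.exp (lam ^ 2 * (((n + 1 : ℕ):ℝ) - 1) / (4 * (1 - ε))) *
          Real.exp (-(ε * (t - s) * ‖ξ‖ ^ 2)) *
          Real.exp (-(((n:ℝ) + 1) * (c * s)) + a * s * ‖ξ‖) := by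
        rw [hW, ← Real.exp_add, ← Real.exp_add, ← Real.exp_add]
        apply Real.exp_le_exp.2
        have h1 := gevrey_exponent ε a (t - s) ‖ξ‖ hε1 (by linarith [hs.2])
        rw [← hc] at h1
        have h2 : lam ^ 2 * (((n + 1 : ℕ):ℝ) - 1) / (4 * (1 - ε)) = n * (c * T) := by
          rw [hcT]; push_cast; ring
        have h3 : (n:ℝ) * (c * s) ≤ n * (c * T) := by
          have : s ≤ T := hs.2.trans ht.2
          gcongr
        rw [h2]
        linarith
      have := mul_le_mul_of_nonneg_right key hb
      linarith
    rw [← mul_assoc, ← ENNReal.ofReal_mul hW0]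
    refine (mul_le_mul_left (ENNReal.ofReal_le_ofReal hk1) _).trans ?_
    rw [ENNReal.ofReal_mul (by positivity), ENNReal.ofReal_mul (by positivity), mul_assoc,
      mul_assoc]
    exact mul_le_mul_right (mul_le_mul_right hcv _) _

end
end

section
/- Let d ≥ 1 and k ≥ 2 be integers and let s be a real number with d/2 − d/k < s < d/2. There exists a constant C = C(d, k, s) such that for all a₁, …, a_k ∈ Ḣ^s(ℝ^d) (with each â_ℓ locally integrable), the product a₁⋯a_k belongs to Ḣ^{ks − (k−1)d/2}(ℝ^d) and ‖a₁⋯a_k‖_{Ḣ^{ks−(k−1)d/2}} ≤ C ‖a₁‖_{Ḣ^s} ⋯ ‖a_k‖_{Ḣ^s}. -/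
open MeasureTheory Real Filter Topology
open scoped ENNReal NNReal

noncomputable section

open FourierTransform SchwartzMap in
lemma swapF {d : ℕ} {f g : Rd d → ℂ} (hf : Integrable f) (hg : Integrable g) :
    ∫ x, 𝓕 f x * g x = ∫ x, f x * 𝓕 g x := by
  have := VectorFourier.integral_fourierIntegral_smul_eq_flip (μ := volume) (ν := volume)
    (L := innerₗ (Rd d)) Real.continuous_fourierChar continuous_inner hf hg
  simpa only [smul_eq_mul, flip_innerₗ] using! this

open FourierTransform SchwartzMap in
lemma swapFinv {d : ℕ} {f g : Rd d → ℂ} (hf : Integrable f) (hg : Integrable g) :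
    ∫ x, 𝓕⁻ f x * g x = ∫ x, f x * 𝓕⁻ g x := by
  have h := swapF hf.comp_neg hg
  simp only [Real.fourierInv_eq_fourier_comp_neg]
  rw [h, ← integral_neg_eq_self]
  simp [← Real.fourierInv_eq_fourier_comp_neg, Real.fourierInv_eq_fourier_neg]

open FourierTransform SchwartzMap in
lemma planchF {d : ℕ} {g : Rd d → ℂ} (hg : Integrable g) (hg2 : MemLp g 2) :
    eLpNorm (𝓕 g) 2 volume = eLpNorm g 2 volume := by
  set G : Lp ℂ 2 (volume : Measure (Rd d)) := hg2.toLp g with hG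
  have hcont : Continuous (𝓕 g) := VectorFourier.fourierIntegral_continuous Real.continuous_fourierChar
      (by exact continuous_inner) hg
  have key : ∀ᵐ x, (𝓕 G : Lp ℂ 2 (volume : Measure (Rd d))) x = 𝓕 g x := by
    apply ae_eq_of_integral_contDiff_smul_eq
    · exact (Lp.memLp _).locallyIntegrable (by norm_num)
    · exact hcont.locallyIntegrable
    · intro φ hφ hφs
      let ψ : 𝓢(Rd d, ℂ) := HasCompactSupport.toSchwartzMap (f := fun x => (φ x : ℂ))
        (hφs.comp_left (g := fun r : ℝ => (r : ℂ)) (by simp)) (Complex.ofRealCLM.contDiff.comp hφ)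
      have hψ : ∀ x, ψ x = φ x := fun x => rfl
      have h1 := congrArg (fun T => T ψ) (Lp.fourier_toTemperedDistribution_eq G)
      simp only [TemperedDistribution.fourier_apply, Lp.toTemperedDistribution_apply] at h1
      have h2 := swapF hg ψ.integrable
      have h3 : ∫ x, (𝓕 ψ) x • G x = ∫ x, g x * 𝓕 (ψ : Rd d → ℂ) x := by
        apply integral_congr_ae
        filter_upwards [hg2.coeFn_toLp] with x hx
        rw [hG, hx, smul_eq_mul, mul_comm, SchwartzMap.fourier_coe]
      simp only [Complex.real_smul]
      rw [h3, ← h2] at h1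
      simp only [hψ, smul_eq_mul] at h1
      rw [← h1]
      simp only [mul_comm]
  rw [← eLpNorm_congr_ae key, ← ENNReal.toReal_eq_toReal_iff' (Lp.memLp _).2.ne hg2.2.ne]
  have := Lp.norm_fourier_eq G
  rw [Lp.norm_def, Lp.norm_def, eLpNorm_congr_ae hg2.coeFn_toLp] at this
  exact this

open FourierTransform SchwartzMap in
lemma planchFinv {d : ℕ} {g : Rd d → ℂ} (hg : Integrable g) (hg2 : MemLp g 2) :
    eLpNorm (𝓕⁻ g) 2 volume = eLpNorm g 2 volume := by
  rw [← planchF hg hg2]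
  have : 𝓕⁻ g = 𝓕 g ∘ Neg.neg := by
    ext x; simp [Real.fourierInv_eq_fourier_neg]
  rw [this]
  have hcont : Continuous (𝓕 g) := VectorFourier.fourierIntegral_continuous Real.continuous_fourierChar
      (by exact continuous_inner) hg
  exact eLpNorm_comp_measurePreserving hcont.aestronglyMeasurable
    (Measure.measurePreserving_neg volume)

lemma interpLk {d k : ℕ} (hk : 2 ≤ k) {u : Rd d → ℂ} {B : ℝ≥0∞} (hB : B ≠ ⊤)
    (hu : ∀ x, ‖u x‖ₑ ≤ B) :
    eLpNorm u k volume ≤ B ^ (1 - 2 / (k:ℝ)) * (eLpNorm u 2 volume) ^ (2 / (k:ℝ)) := by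
  have hk0 : (0:ℝ) < k := by exact_mod_cast (by omega : 0 < k)
  have hk2 : (2:ℝ) ≤ k := by exact_mod_cast hk
  rw [eLpNorm_eq_lintegral_rpow_enorm_toReal (by simp; omega) (by simp),
    eLpNorm_eq_lintegral_rpow_enorm_toReal (by simp) (by simp)]
  simp only [ENNReal.toReal_natCast, ENNReal.toReal_ofNat]
  have h1 : ∫⁻ x, ‖u x‖ₑ ^ (k:ℝ) ≤ B ^ ((k:ℝ) - 2) * ∫⁻ x, ‖u x‖ₑ ^ (2:ℝ) := by
    rw [← lintegral_const_mul' _ _ (ENNReal.rpow_ne_top_of_nonneg (by linarith) hB)]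
    apply lintegral_mono
    intro x
    have : ‖u x‖ₑ ^ (k:ℝ) = ‖u x‖ₑ ^ ((k:ℝ)-2) * ‖u x‖ₑ ^ (2:ℝ) := by
      rw [← ENNReal.rpow_add_of_nonneg _ _ (by linarith) (by norm_num)]; ring_nf
    simp only [this]
    gcongr
    exact hu x
  calc _ ≤ (B ^ ((k:ℝ) - 2) * ∫⁻ x, ‖u x‖ₑ ^ (2:ℝ)) ^ (1 / (k:ℝ)) := by gcongr
    _ = _ := by
      rw [ENNReal.mul_rpow_of_nonneg _ _ (by positivity), ← ENNReal.rpow_mul, ← ENNReal.rpow_mul]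
      congr 2 <;> field_simp

open FourierTransform in
lemma contF {d : ℕ} {g : Rd d → ℂ} (hg : Integrable g) : Continuous (𝓕 g) :=
  VectorFourier.fourierIntegral_continuous Real.continuous_fourierChar
      (by exact continuous_inner) hg

open FourierTransform in
lemma contFinv {d : ℕ} {g : Rd d → ℂ} (hg : Integrable g) : Continuous (𝓕⁻ g) := by
  rw [Real.fourierInv_eq_fourier_comp_neg]; exact contF hg.comp_neg

open FourierTransform in
lemma boundF {d : ℕ} (g : Rd d → ℂ) (x : Rd d) : ‖𝓕 g x‖ ≤ ∫ y, ‖g y‖ :=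
  VectorFourier.norm_fourierIntegral_le_integral_norm _ _ _ _ _

open FourierTransform in
lemma boundFinv {d : ℕ} {g : Rd d → ℂ} (hg : Integrable g) (x : Rd d) :
    ‖𝓕⁻ g x‖ₑ ≤ eLpNorm g 1 volume := by
  rw [Real.fourierInv_eq_fourier_neg, eLpNorm_one_eq_lintegral_enorm,
    ← ofReal_integral_norm_eq_lintegral_enorm hg, ← ofReal_norm]
  exact ENNReal.ofReal_le_ofReal (boundF g _)

open FourierTransform in
lemma memLp_ind {d : ℕ} {a : Rd d → ℂ} (ha : Integrable a) {S : Set (Rd d)}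
    (hS : MeasurableSet S) (hS' : volume S < ⊤) (p : ℝ≥0∞) :
    MemLp (S.indicator (𝓕 a)) p volume := by
  rw [memLp_indicator_iff_restrict hS]
  have : IsFiniteMeasure (volume.restrict S) := ⟨by simpa using hS'⟩
  exact MemLp.of_bound (contF ha).aestronglyMeasurable _ (ae_of_all _ (boundF a))

open FourierTransform in
lemma annulus_l2 {d : ℕ} {s : ℝ} (hs : 0 < s) (f : Rd d → ℂ) {R : ℝ} (hR : 0 < R)
    {S : Set (Rd d)} (hSR : ∀ x ∈ S, R ≤ ‖x‖) :
    eLpNorm (S.indicator f) 2 volume ≤ ENNReal.ofReal (R ^ (-s)) * hSobC d s f := by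
  rw [eLpNorm_eq_lintegral_rpow_enorm_toReal (by simp) (by simp)]
  simp only [ENNReal.toReal_ofNat, hSobC]
  have h0 : ENNReal.ofReal (R ^ (-s)) = (ENNReal.ofReal (R ^ (-(2*s)))) ^ (1/2:ℝ) := by
    rw [ENNReal.ofReal_rpow_of_nonneg (by positivity) (by norm_num), ← Real.rpow_mul hR.le]
    ring_nf
  rw [h0, ← ENNReal.mul_rpow_of_nonneg _ _ (by norm_num),
    ← lintegral_const_mul' _ _ ENNReal.ofReal_ne_top]
  gcongr with x
  by_cases hx : x ∈ S
  · simp only [Set.indicator_of_mem hx]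
    rw [← ENNReal.ofReal_mul (by positivity), ← ofReal_norm,
      ENNReal.ofReal_rpow_of_nonneg (by positivity) (by norm_num)]
    apply ENNReal.ofReal_le_ofReal
    rw [← mul_assoc]
    have h1 : R ^ (2*s) ≤ ‖x‖ ^ (2*s) := Real.rpow_le_rpow hR.le (hSR x hx) (by linarith)
    have h2 : R ^ (-(2*s)) * R ^ (2*s) = 1 := by
      rw [← Real.rpow_add hR]; simp
    have h3 : 1 ≤ R ^ (-(2*s)) * ‖x‖ ^ (2*s) := by
      rw [← h2]; gcongr
    rw [Real.rpow_two]
    nlinarith [sq_nonneg ‖f x‖]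
  · simp [Set.indicator_of_notMem hx]

open FourierTransform in
/-- frequency truncation -/
def cutF (d : ℕ) (a : Rd d → ℂ) (n : ℕ) : Rd d → ℂ :=
  𝓕⁻ ((Metric.ball (0 : Rd d) (2 ^ n)).indicator (𝓕 a))

open FourierTransform in
lemma Finv_sub {d : ℕ} {f g : Rd d → ℂ} (hf : Integrable f) (hg : Integrable g) :
    𝓕⁻ (f - g) = 𝓕⁻ f - 𝓕⁻ g := by
  ext x
  simp only [Real.fourierInv_eq', Pi.sub_apply, smul_sub]
  rw [integral_sub]
  · simpa [Real.fourierChar_apply, Circle.smul_def, Real.fourierInv_eq'] using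
     (Real.fourierIntegral_convergent_iff (-x)).2 hf |>.congr (ae_of_all _ fun v => by
       simp [Real.fourierChar_apply, Circle.smul_def])
  · simpa [Real.fourierChar_apply, Circle.smul_def, Real.fourierInv_eq'] using
     (Real.fourierIntegral_convergent_iff (-x)).2 hg |>.congr (ae_of_all _ fun v => by
       simp [Real.fourierChar_apply, Circle.smul_def])

open FourierTransform in
lemma cut_diff {d k : ℕ} (hk : 2 ≤ k) {s : ℝ} (hs : 0 < s) {a : Rd d → ℂ} (ha : Integrable a)
    (hA : hSobC d s (𝓕 a) < ⊤) : ∃ K : ℝ, ∀ n, eLpNorm (cutF d a (n+1) - cutF d a n) k volume ≤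
      ENNReal.ofReal (K * (2 ^ ((d:ℝ)/2 - d/k - s)) ^ n) := by
  have hk0 : (0:ℝ) < k := by exact_mod_cast (by omega : 0 < k)
  have hk2 : (2:ℝ) ≤ k := by exact_mod_cast hk
  have hk2' : 2 / (k:ℝ) ≤ 1 := by rw [div_le_one hk0]; exact hk2
  set A := (hSobC d s (𝓕 a)).toReal with hAdef
  have hA' : hSobC d s (𝓕 a) = ENNReal.ofReal A := (ENNReal.ofReal_toReal hA.ne).symm
  have hA0 : 0 ≤ A := ENNReal.toReal_nonneg
  set V := (volume (Metric.ball (0 : Rd d) 1)).toReal with hVdef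
  have hV : volume (Metric.ball (0 : Rd d) 1) = ENNReal.ofReal V :=
    (ENNReal.ofReal_toReal measure_ball_lt_top.ne).symm
  have hV0 : 0 ≤ V := ENNReal.toReal_nonneg
  refine ⟨A * (2 ^ (d:ℝ) * V) ^ ((1/2:ℝ) * (1 - 2/(k:ℝ))), fun n => ?_⟩
  set S : Set (Rd d) := Metric.ball 0 (2^(n+1)) \ Metric.ball 0 (2^n) with hSdef
  have hS : MeasurableSet S := measurableSet_ball.diff measurableSet_ball
  have hSv : volume S ≤ ENNReal.ofReal ((2^(n+1))^d * V) := by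
    calc volume S ≤ volume (Metric.ball (0:Rd d) (2^(n+1))) := measure_mono Set.sdiff_subset
      _ = _ := by
        rw [Measure.addHaar_ball_of_pos _ _ (by positivity), hV, ENNReal.ofReal_mul (by positivity)]
        simp
  have hSf : volume S < ⊤ := hSv.trans_lt ENNReal.ofReal_lt_top
  have hb : ∀ m : ℕ, Integrable ((Metric.ball (0 : Rd d) (2 ^ m)).indicator (𝓕 a)) := fun m =>
    memLp_one_iff_integrable.1 (memLp_ind ha measurableSet_ball measure_ball_lt_top 1)
  set g := S.indicator (𝓕 a) with hg
  have hg1 : Integrable g := memLp_one_iff_integrable.1 (memLp_ind ha hS hSf 1)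
  have hg2 : MemLp g 2 := memLp_ind ha hS hSf 2
  have heq : cutF d a (n+1) - cutF d a n = 𝓕⁻ g := by
    rw [cutF, cutF, ← Finv_sub (hb _) (hb _)]
    congr 1
    rw [hg, Set.indicator_sdiff' (Metric.ball_subset_ball (pow_le_pow_right₀ (by norm_num) (by omega))),
      sub_eq_add_neg]
  have hn2 : eLpNorm g 2 volume ≤ ENNReal.ofReal ((2^n:ℝ) ^ (-s) * A) := by
    rw [ENNReal.ofReal_mul (by positivity), ← hA']
    exact annulus_l2 hs _ (by positivity) (fun x hx => by simpa using hx.2)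
  have hn1 : eLpNorm g 1 volume ≤
      ENNReal.ofReal ((2^n:ℝ) ^ (-s) * A * ((2^(n+1))^d * V) ^ (1/2:ℝ)) := by
    have h := eLpNorm_le_eLpNorm_mul_rpow_measure_univ (μ := volume.restrict S) (p := 1) (q := 2)
      (by norm_num) (contF ha).aestronglyMeasurable
    rw [← eLpNorm_indicator_eq_eLpNorm_restrict hS, ← eLpNorm_indicator_eq_eLpNorm_restrict hS,
      ← hg] at h
    refine h.trans ?_
    rw [ENNReal.ofReal_mul (by positivity), ← ENNReal.ofReal_rpow_of_nonneg (by positivity) (by norm_num)]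
    have : (1 / (1:ℝ≥0∞).toReal - 1 / (2:ℝ≥0∞).toReal) = 1/2 := by norm_num
    rw [this, Measure.restrict_apply_univ]
    gcongr
  rw [heq]
  have hi := interpLk hk (u := 𝓕⁻ g) (ENNReal.ofReal_ne_top) (fun x => (boundFinv hg1 x).trans hn1)
  rw [planchFinv hg1 hg2] at hi
  refine hi.trans ?_
  have hX : 0 ≤ (2^n:ℝ) ^ (-s) * A := by positivity
  calc _ ≤ ENNReal.ofReal ((2^n:ℝ) ^ (-s) * A * ((2^(n+1))^d * V) ^ (1/2:ℝ)) ^ (1 - 2 / (k:ℝ)) *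
        ENNReal.ofReal ((2^n:ℝ) ^ (-s) * A) ^ (2 / (k:ℝ)) := by gcongr
    _ = _ := by
      rw [ENNReal.ofReal_rpow_of_nonneg (by positivity) (by linarith),
        ENNReal.ofReal_rpow_of_nonneg (by positivity) (by positivity),
        ← ENNReal.ofReal_mul (by positivity)]
      congr 1
      rw [Real.mul_rpow hX (by positivity), mul_right_comm,
        ← Real.rpow_add_of_nonneg hX (by linarith) (by positivity)]
      have e1 : (1 - 2 / (k:ℝ) + 2 / (k:ℝ)) = 1 := by ring
      rw [e1, Real.rpow_one, ← Real.rpow_mul (by positivity)]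
      have e2 : ((2:ℝ)^(n+1))^d * V = (2:ℝ)^((n:ℝ) * d) * (2 ^ (d:ℝ) * V) := by
        rw [← mul_assoc, ← Real.rpow_add (by norm_num), ← pow_mul, ← Real.rpow_natCast]
        push_cast; ring_nf
      rw [e2, Real.mul_rpow (by positivity) (by positivity), ← Real.rpow_natCast 2 n,
        ← Real.rpow_natCast _ n, ← Real.rpow_mul (by norm_num), ← Real.rpow_mul (by norm_num),
        ← Real.rpow_mul (by norm_num)]
      have e3 : ((d:ℝ)/2 - d/k - s) * n = n * (-s) + n * d * (1/2 * (1 - 2/k)) := by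
        field_simp; ring
      rw [e3, Real.rpow_add (by norm_num)]
      ring

open FourierTransform in
lemma cut_memLp {d k : ℕ} (hk : 2 ≤ k) {a : Rd d → ℂ} (ha : Integrable a) (n : ℕ) :
    MemLp (cutF d a n) k volume := by
  have h1 := memLp_ind ha (S := Metric.ball (0 : Rd d) (2 ^ n)) measurableSet_ball
    measure_ball_lt_top 1
  have h2 := memLp_ind ha (S := Metric.ball (0 : Rd d) (2 ^ n)) measurableSet_ball
    measure_ball_lt_top 2
  have h1' := memLp_one_iff_integrable.1 h1
  refine ⟨(contFinv h1').aestronglyMeasurable, ?_⟩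
  have hk2 : (2:ℝ) ≤ k := by exact_mod_cast hk
  have hk2' : 2 / (k:ℝ) ≤ 1 := by rw [div_le_one (by linarith)]; exact hk2
  refine (interpLk hk h1.2.ne (boundFinv h1')).trans_lt ?_
  rw [planchFinv h1' h2]
  exact ENNReal.mul_lt_top (ENNReal.rpow_lt_top_of_nonneg (by linarith) h1.2.ne)
    (ENNReal.rpow_lt_top_of_nonneg (by positivity) h2.2.ne)

open FourierTransform SchwartzMap in
lemma cut_weak {d : ℕ} {a : Rd d → ℂ} (ha : Integrable a) (ψ : 𝓢(Rd d, ℂ)) :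
    Tendsto (fun n => ∫ x, ψ x * cutF d a n x) atTop (𝓝 (∫ x, ψ x * a x)) := by
  have hψ : Integrable (𝓕⁻ (ψ : Rd d → ℂ)) := by
    rw [← SchwartzMap.fourierInv_coe]; exact SchwartzMap.integrable _
  have h1 : ∀ n, ∫ x, ψ x * cutF d a n x =
      ∫ x, 𝓕⁻ (ψ : Rd d → ℂ) x * (Metric.ball (0 : Rd d) (2 ^ n)).indicator (𝓕 a) x := by
    intro n
    exact (swapFinv ψ.integrable (memLp_one_iff_integrable.1
      (memLp_ind ha measurableSet_ball measure_ball_lt_top 1))).symm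
  have h2 : ∫ x, ψ x * a x = ∫ x, 𝓕⁻ (ψ : Rd d → ℂ) x * 𝓕 a x := by
    rw [← swapF hψ ha]
    congr 1
    ext x
    rw [ψ.continuous.fourier_fourierInv_eq ψ.integrable]
    rw [← SchwartzMap.fourier_coe]; exact SchwartzMap.integrable _
  simp only [h1, h2]
  apply tendsto_integral_of_dominated_convergence
    (fun x => ‖𝓕⁻ (ψ : Rd d → ℂ) x‖ * ∫ y, ‖a y‖)
  · intro n
    exact hψ.1.mul (memLp_ind ha measurableSet_ball measure_ball_lt_top 1).1
  · exact hψ.norm.mul_const _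
  · intro n
    refine ae_of_all _ fun x => ?_
    rw [norm_mul]
    gcongr
    exact (norm_indicator_le_norm_self _ _).trans (boundF a x)
  · refine ae_of_all _ fun x => ?_
    apply tendsto_const_nhds.congr'
    obtain ⟨N, hN⟩ := pow_unbounded_of_one_lt ‖x‖ (one_lt_two : (1:ℝ) < 2)
    filter_upwards [eventually_ge_atTop N] with n hn
    rw [Set.indicator_of_mem]
    simpa using hN.trans_le (pow_le_pow_right₀ (by norm_num) hn)

open FourierTransform SchwartzMap in
lemma cut_tendsto {d k : ℕ} (hk : 2 ≤ k) {s : ℝ} (hs : (d:ℝ)/2 - d/k < s) {a : Rd d → ℂ}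
    (ha : Integrable a) (hA : hSobC d s (𝓕 a) < ⊤) :
    MemLp a k volume ∧ Tendsto (fun n => eLpNorm (cutF d a n - a) k volume) atTop (𝓝 0) := by
  have hk2 : (2:ℝ) ≤ k := by exact_mod_cast hk
  have hs0 : 0 < s := by
    refine lt_of_le_of_lt ?_ hs
    have : (d:ℝ)/k ≤ d/2 := by gcongr
    linarith
  obtain ⟨K, hK⟩ := cut_diff hk hs0 ha hA
  have : Fact (1 ≤ (k:ℝ≥0∞)) := ⟨by exact_mod_cast (by omega : 1 ≤ k)⟩
  have hm := fun n => cut_memLp hk ha n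
  set c : ℕ → Lp ℂ (k:ℝ≥0∞) (volume : Measure (Rd d)) := fun n => (hm n).toLp _ with hc
  have hr : (2:ℝ) ^ ((d:ℝ)/2 - d/k - s) < 1 := Real.rpow_lt_one_of_one_lt_of_neg (by norm_num) (by linarith)
  have hK' : ∀ n, dist (c n) (c (n+1)) ≤ max K 0 * ((2:ℝ) ^ ((d:ℝ)/2 - d/k - s)) ^ n := by
    intro n
    rw [dist_comm, Lp.dist_def]
    apply ENNReal.toReal_le_of_le_ofReal (by positivity)
    rw [eLpNorm_congr_ae ((hm (n+1)).coeFn_toLp.sub (hm n).coeFn_toLp)]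
    refine (hK n).trans (ENNReal.ofReal_le_ofReal ?_)
    gcongr
    exact le_max_left _ _
  obtain ⟨v, hv⟩ := cauchySeq_tendsto_of_complete (cauchySeq_of_le_geometric _ _ hr hK')
  have hav : ∀ᵐ x, v x = a x := by
    apply ae_eq_of_integral_contDiff_smul_eq
    · exact (Lp.memLp _).locallyIntegrable (Fact.out)
    · exact ha.locallyIntegrable
    · intro φ hφ hφs
      let ψ : 𝓢(Rd d, ℂ) := HasCompactSupport.toSchwartzMap (f := fun x => (φ x : ℂ))
        (hφs.comp_left (g := fun r : ℝ => (r : ℂ)) (by simp)) (Complex.ofRealCLM.contDiff.comp hφ)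
      have hψ : ∀ x, ψ x = φ x := fun x => rfl
      have t1 : Tendsto (fun n => Lp.toTemperedDistribution (c n) ψ) atTop
          (𝓝 (Lp.toTemperedDistribution v ψ)) := by
        have := ((Lp.toTemperedDistributionCLM ℂ (volume : Measure (Rd d)) k).continuous.tendsto v).comp hv
        exact ((PointwiseConvergenceCLM.evalCLM _ _ ψ).continuous.tendsto _).comp this
      have t2 : Tendsto (fun n => Lp.toTemperedDistribution (c n) ψ) atTop
          (𝓝 (∫ x, ψ x * a x)) := by
        refine (cut_weak ha ψ).congr fun n => ?_
        rw [Lp.toTemperedDistribution_apply]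
        apply integral_congr_ae
        filter_upwards [(hm n).coeFn_toLp] with x hx
        rw [hc]; simp only [hx, smul_eq_mul]
      have := tendsto_nhds_unique t1 t2
      rw [Lp.toTemperedDistribution_apply] at this
      simpa [hψ] using this
  refine ⟨(memLp_congr_ae hav).1 (Lp.memLp v), ?_⟩
  have := (Lp.tendsto_Lp_iff_tendsto_eLpNorm' _ _).1 hv
  refine this.congr fun n => ?_
  exact eLpNorm_congr_ae ((hm n).coeFn_toLp.sub hav)

open FourierTransform in
lemma F_mul_Finv {d : ℕ} {b g : Rd d → ℂ} (hb : Integrable b) (hg : Integrable g) (ξ : Rd d) :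
    𝓕 (b * 𝓕⁻ g) ξ = ∫ η, g η * 𝓕 b (ξ - η) := by
  have hb' : Integrable (fun x => (Real.fourierChar (-(inner ℝ x ξ)) : ℂ) * b x) := by
    simpa [Circle.smul_def] using (Real.fourierIntegral_convergent_iff ξ).2 hb
  have h := swapFinv hb' hg
  rw [Real.fourier_eq]
  calc _ = ∫ x, (Real.fourierChar (-(inner ℝ x ξ)) : ℂ) * b x * 𝓕⁻ g x := by
        congr 1; ext x; simp [Circle.smul_def, mul_assoc]
    _ = _ := by
      rw [← h]
      congr 1; ext η
      rw [mul_comm]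
      congr 1
      rw [Real.fourierInv_eq, Real.fourier_eq]
      congr 1; ext x
      simp only [Circle.smul_def, smul_eq_mul, ← mul_assoc]
      rw [← Circle.coe_mul, ← AddChar.map_add_eq_mul]
      congr 3
      rw [inner_sub_right]; ring_nf

open FourierTransform in
/-- iterated convolution of the moduli of the Fourier transforms -/
def convH (d : ℕ) (a : ℕ → Rd d → ℂ) : ℕ → Rd d → ℝ≥0∞
  | 0 => fun ξ => ‖𝓕 (a 0) ξ‖ₑ
  | j + 1 => fun ξ => ∫⁻ η, ‖𝓕 (a (j+1)) η‖ₑ * convH d a j (ξ - η)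

/-- truncated product -/
def cutP (d : ℕ) (a : ℕ → Rd d → ℂ) (n : ℕ) : ℕ → Rd d → ℂ
  | 0 => a 0
  | j + 1 => cutP d a n j * cutF d (a (j+1)) n

/-- product -/
def fullP (d : ℕ) (a : ℕ → Rd d → ℂ) : ℕ → Rd d → ℂ
  | 0 => a 0
  | j + 1 => fullP d a j * a (j+1)

open FourierTransform in
lemma ind_int {d : ℕ} {a : Rd d → ℂ} (ha : Integrable a) (n : ℕ) :
    Integrable ((Metric.ball (0 : Rd d) (2 ^ n)).indicator (𝓕 a)) :=
  memLp_one_iff_integrable.1 (memLp_ind ha measurableSet_ball measure_ball_lt_top 1)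

lemma cutP_int {d : ℕ} {a : ℕ → Rd d → ℂ} (ha : ∀ i, Integrable (a i)) (n j : ℕ) :
    Integrable (cutP d a n j) := by
  induction j with
  | zero => exact ha 0
  | succ j ih =>
    have h1 := ind_int (ha (j+1)) n
    refine ih.mul_bdd (c := (eLpNorm ((Metric.ball (0 : Rd d) (2 ^ n)).indicator
      (FourierTransform.fourier (a (j+1)))) 1 volume).toReal) (contFinv h1).aestronglyMeasurable ?_
    refine ae_of_all _ fun x => ?_
    have := boundFinv h1 x
    rw [← ofReal_norm] at this
    exact (ENNReal.ofReal_le_iff_le_toReal (memLp_one_iff_integrable.2 h1).2.ne).1 this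

open FourierTransform in
lemma cutP_bound {d : ℕ} {a : ℕ → Rd d → ℂ} (ha : ∀ i, Integrable (a i)) (n j : ℕ) (ξ : Rd d) :
    ‖𝓕 (cutP d a n j) ξ‖ₑ ≤ convH d a j ξ := by
  induction j generalizing ξ with
  | zero => exact le_rfl
  | succ j ih =>
    have h1 := ind_int (ha (j+1)) n
    rw [cutP, cutF, F_mul_Finv (cutP_int ha n j) h1, convH]
    refine (enorm_integral_le_lintegral_enorm _).trans ?_
    apply lintegral_mono
    intro η
    simp only [enorm_mul]
    gcongr
    · exact enorm_indicator_le_enorm_self _ _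
    · exact ih _

lemma mul_tendsto {d : ℕ} {p q r : ℝ≥0∞} [ENNReal.HolderTriple p q r] (hr : 1 ≤ r)
    {f : ℕ → Rd d → ℂ} {F : Rd d → ℂ} {g : ℕ → Rd d → ℂ} {G : Rd d → ℂ}
    (hp : 1 ≤ p) (hf : ∀ n, MemLp (f n) p) (hF : MemLp F p)
    (hg : ∀ n, MemLp (g n) q) (hG : MemLp G q)
    (h1 : Tendsto (fun n => eLpNorm (f n - F) p volume) atTop (𝓝 0))
    (h2 : Tendsto (fun n => eLpNorm (g n - G) q volume) atTop (𝓝 0)) :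
    Tendsto (fun n => eLpNorm (f n * g n - F * G) r volume) atTop (𝓝 0) := by
  have hb : ∀ n, eLpNorm (f n * g n - F * G) r volume ≤
      (eLpNorm (f n - F) p volume + eLpNorm F p volume) * eLpNorm (g n - G) q volume +
        eLpNorm (f n - F) p volume * eLpNorm G q volume := by
    intro n
    have e : f n * g n - F * G = f n • (g n - G) + (f n - F) • G := by
      simp only [smul_eq_mul]; ring
    rw [e]
    refine (eLpNorm_add_le (((hf n).1).smul ((hg n).1.sub hG.1))
      (((hf n).1.sub hF.1).smul hG.1) hr).trans ?_
    refine add_le_add ((eLpNorm_smul_le_mul_eLpNorm (p := p) (q := q) ((hg n).1.sub hG.1) (hf n).1).trans ?_)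
      (eLpNorm_smul_le_mul_eLpNorm (p := p) (q := q) hG.1 ((hf n).1.sub hF.1))
    gcongr
    calc eLpNorm (f n) p volume = eLpNorm ((f n - F) + F) p volume := by simp
      _ ≤ _ := eLpNorm_add_le ((hf n).1.sub hF.1) hF.1 hp
  refine tendsto_of_tendsto_of_tendsto_of_le_of_le tendsto_const_nhds ?_ (fun n => zero_le) hb
  have t1 : Tendsto (fun n => eLpNorm (f n - F) p volume + eLpNorm F p volume) atTop
      (𝓝 (0 + eLpNorm F p volume)) := h1.add_const _
  have t2 := ENNReal.Tendsto.mul t1 (Or.inr ENNReal.zero_ne_top) h2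
    (Or.inr (by simpa using hF.2.ne))
  have t3 := ENNReal.Tendsto.mul_const h1 (Or.inr hG.2.ne) (b := eLpNorm G q volume)
  simpa using t2.add t3

lemma cutP_tendsto {d k : ℕ} (hk : 2 ≤ k) {a : ℕ → Rd d → ℂ} (ha : ∀ i, Integrable (a i))
    (hL : ∀ i, MemLp (a i) k)
    (hT : ∀ i, Tendsto (fun n => eLpNorm (cutF d (a i) n - a i) k volume) atTop (𝓝 0))
    (j : ℕ) (hj : j + 1 ≤ k) :
    (∀ n, MemLp (cutP d a n j) (((j+1 : ℕ) : ℝ≥0∞) * (k:ℝ≥0∞)⁻¹)⁻¹) ∧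
    MemLp (fullP d a j) (((j+1 : ℕ) : ℝ≥0∞) * (k:ℝ≥0∞)⁻¹)⁻¹ ∧
    Tendsto (fun n => eLpNorm (cutP d a n j - fullP d a j) (((j+1 : ℕ) : ℝ≥0∞) * (k:ℝ≥0∞)⁻¹)⁻¹ volume)
      atTop (𝓝 0) := by
  have hk0 : (k:ℝ≥0∞) ≠ 0 := by simp; omega
  have hle : ∀ i : ℕ, i ≤ k → 1 ≤ (((i : ℕ) : ℝ≥0∞) * (k:ℝ≥0∞)⁻¹)⁻¹ := by
    intro i hi
    rw [ENNReal.one_le_inv]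
    calc (i:ℝ≥0∞) * (k:ℝ≥0∞)⁻¹ ≤ k * (k:ℝ≥0∞)⁻¹ := by gcongr
      _ = 1 := ENNReal.mul_inv_cancel hk0 (by simp)
  induction j with
  | zero =>
    simp only [zero_add, Nat.cast_one, one_mul, inv_inv, cutP, fullP, sub_self]
    exact ⟨fun _ => hL 0, hL 0, by simp⟩
  | succ j ih =>
    obtain ⟨i1, i2, i3⟩ := ih (by omega)
    have hH : ENNReal.HolderTriple (((j+1 : ℕ) : ℝ≥0∞) * (k:ℝ≥0∞)⁻¹)⁻¹ (k:ℝ≥0∞)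
        (((j+1+1 : ℕ) : ℝ≥0∞) * (k:ℝ≥0∞)⁻¹)⁻¹ := ⟨by
      simp only [inv_inv]; push_cast; ring⟩
    refine ⟨fun n => (cut_memLp hk (ha (j+1)) n).mul (i1 n), (hL (j+1)).mul i2, ?_⟩
    exact mul_tendsto (hle _ hj) (hle _ (by omega)) i1 i2 (fun n => cut_memLp hk (ha (j+1)) n)
      (hL (j+1)) i3 (hT (j+1))

open FourierTransform in
lemma fullP_bound {d k : ℕ} (hk : 2 ≤ k) {a : ℕ → Rd d → ℂ} (ha : ∀ i, Integrable (a i))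
    {s : ℝ} (hs : (d:ℝ)/2 - d/k < s) (hA : ∀ i, hSobC d s (𝓕 (a i)) < ⊤) (ξ : Rd d) :
    ‖𝓕 (fullP d a (k-1)) ξ‖ₑ ≤ convH d a (k-1) ξ := by
  obtain ⟨_, h2, h3⟩ := cutP_tendsto hk ha (fun i => (cut_tendsto hk hs (ha i) (hA i)).1)
    (fun i => (cut_tendsto hk hs (ha i) (hA i)).2) (k-1) (by omega)
  have e : (((k-1+1 : ℕ) : ℝ≥0∞) * (k:ℝ≥0∞)⁻¹)⁻¹ = 1 := by
    rw [Nat.sub_add_cancel (by omega), ENNReal.mul_inv_cancel (by simp; omega) (by simp), inv_one]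
  rw [e] at h2 h3
  have hP := memLp_one_iff_integrable.1 h2
  have hb : ∀ n, ‖𝓕 (fullP d a (k-1)) ξ‖ₑ ≤ convH d a (k-1) ξ +
      eLpNorm (cutP d a n (k-1) - fullP d a (k-1)) 1 volume := by
    intro n
    have hC := cutP_int ha n (k-1)
    have e2 : 𝓕 (fullP d a (k-1)) ξ = 𝓕 (cutP d a n (k-1)) ξ -
        𝓕⁻ (cutP d a n (k-1) - fullP d a (k-1)) (-ξ) := by
      rw [Finv_sub hC hP]
      simp [Real.fourierInv_eq_fourier_neg]
    rw [e2]
    refine enorm_sub_le.trans (add_le_add (cutP_bound ha n _ ξ) (boundFinv (hC.sub hP) _))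
  have := ge_of_tendsto' (h3.const_add (convH d a (k-1) ξ)) hb
  simpa using this

/-- homogeneous weight -/
def WW (d : ℕ) (t : ℝ) (ξ : Rd d) : ℝ≥0∞ := ENNReal.ofReal (‖ξ‖ ^ t)

lemma WW_meas (d : ℕ) (t : ℝ) : Measurable (WW d t) := by
  unfold WW; fun_prop

lemma WW_ne_top {d : ℕ} {t : ℝ} {ξ : Rd d} : WW d t ξ ≠ ⊤ := ENNReal.ofReal_ne_top

lemma WW_add {d : ℕ} {ξ : Rd d} (h : ξ ≠ 0) (s t : ℝ) : WW d (s + t) ξ = WW d s ξ * WW d t ξ := by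
  rw [WW, WW, WW, Real.rpow_add (norm_pos_iff.2 h), ENNReal.ofReal_mul (by positivity)]

lemma WW_zero {d : ℕ} {ξ : Rd d} : WW d 0 ξ = 1 := by simp [WW]

lemma WW_sq {d : ℕ} {ξ : Rd d} (h : ξ ≠ 0) (s : ℝ) : WW d s ξ ^ 2 = WW d (2 * s) ξ := by
  rw [two_mul, WW_add h, sq]

lemma rpow_comp {x y K : ℝ} (hx : 0 < x) (hy : 0 < y) (hK : 0 < K) (h1 : x ≤ K * y)
    (h2 : y ≤ K * x) (t : ℝ) : x ^ t ≤ K ^ |t| * y ^ t := by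
  rcases le_total 0 t with ht | ht
  · rw [abs_of_nonneg ht, ← Real.mul_rpow hK.le hy.le]
    exact Real.rpow_le_rpow hx.le h1 ht
  · rw [abs_of_nonpos ht, Real.rpow_neg hK.le, ← Real.inv_rpow hK.le,
      ← Real.mul_rpow (by positivity) hy.le]
    apply Real.rpow_le_rpow_of_nonpos (by positivity) _ ht
    rw [inv_mul_le_iff₀ hK]; exact h2

lemma WW_comp {d : ℕ} {x y : Rd d} {K : ℝ} (hx : x ≠ 0) (hy : y ≠ 0) (hK : 0 < K)
    (h1 : ‖x‖ ≤ K * ‖y‖) (h2 : ‖y‖ ≤ K * ‖x‖) (t : ℝ) :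
    WW d t x ≤ ENNReal.ofReal (K ^ |t|) * WW d t y := by
  rw [WW, WW, ← ENNReal.ofReal_mul (by positivity)]
  exact ENNReal.ofReal_le_ofReal (rpow_comp (norm_pos_iff.2 hx) (norm_pos_iff.2 hy) hK h1 h2 t)

lemma ball_int {d : ℕ} (hd : 1 ≤ d) {γ : ℝ} (hγ : -(d:ℝ) < γ) : ∃ c : ℝ≥0∞, c ≠ ⊤ ∧
    ∀ r : ℝ, 0 < r → ∫⁻ η in Metric.ball (0 : Rd d) r, WW d γ η ≤ c * ENNReal.ofReal (r ^ (d + γ)) := by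
  have : NeZero d := ⟨by omega⟩
  have hI : ∀ r : ℝ, 0 < r → IntegrableOn (fun x : Rd d => ‖x‖ ^ γ) (Metric.ball 0 r) := by
    intro r hr
    rw [integrableOn_fun_norm_addHaar volume (f := fun y : ℝ => y ^ γ)]
    have h := (intervalIntegral.intervalIntegrable_rpow' (a := 0) (b := r)
      (r := (d:ℝ) - 1 + γ) (by linarith))
    rw [intervalIntegrable_iff_integrableOn_Ioo_of_le hr.le] at h
    refine h.congr_fun ?_ measurableSet_Ioo
    intro y hy
    simp only [finrank_euclideanSpace, Fintype.card_fin, smul_eq_mul]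
    rw [Real.rpow_add hy.1, ← Real.rpow_natCast, Nat.cast_sub hd, Nat.cast_one]
  refine ⟨ENNReal.ofReal (∫ x in Metric.ball (0 : Rd d) 1, ‖x‖ ^ γ), ENNReal.ofReal_ne_top, ?_⟩
  intro r hr
  unfold WW
  rw [← ofReal_integral_eq_lintegral_ofReal (hI r hr) (ae_of_all _ fun x => by positivity),
    ← ENNReal.ofReal_mul (by positivity)]
  apply ENNReal.ofReal_le_ofReal
  have h := Measure.setIntegral_comp_smul_of_pos (volume : Measure (Rd d))
    (fun x : Rd d => ‖x‖ ^ γ) (Metric.ball 0 1) hr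
  rw [smul_unitBall_of_pos hr] at h
  simp only [norm_smul, finrank_euclideanSpace, Fintype.card_fin, smul_eq_mul, Real.norm_eq_abs,
    abs_of_pos hr] at h
  have h' : ∫ x in Metric.ball (0 : Rd d) 1, (r * ‖x‖) ^ γ =
      r ^ γ * ∫ x in Metric.ball (0 : Rd d) 1, ‖x‖ ^ γ := by
    rw [← integral_const_mul]
    congr 1; ext x
    rw [Real.mul_rpow hr.le (norm_nonneg _)]
  rw [h'] at h
  rw [Real.rpow_add hr, Real.rpow_natCast]
  have : ∫ x in Metric.ball (0 : Rd d) r, ‖x‖ ^ γ = r ^ d * (r ^ γ * ∫ x in Metric.ball (0 : Rd d) 1, ‖x‖ ^ γ) := by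
    rw [h, ← mul_assoc, mul_inv_cancel₀ (by positivity), one_mul]
  rw [this]; apply le_of_eq; ring

lemma CS {α : Type*} [MeasurableSpace α] (μ : Measure α) {u v : α → ℝ≥0∞}
    (hu : AEMeasurable u μ) (hv : AEMeasurable v μ) :
    (∫⁻ x, u x * v x ∂μ) ^ 2 ≤ (∫⁻ x, u x ^ 2 ∂μ) * ∫⁻ x, v x ^ 2 ∂μ := by
  have h := ENNReal.lintegral_mul_le_Lp_mul_Lq μ Real.HolderConjugate.two_two hu hv
  have h2 := pow_le_pow_left₀ zero_le h 2
  refine h2.trans (le_of_eq ?_)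
  rw [mul_pow, ← ENNReal.rpow_natCast, ← ENNReal.rpow_natCast, ← ENNReal.rpow_mul, ← ENNReal.rpow_mul]
  norm_num

lemma tonelli {d : ℕ} {A B : Rd d → ℝ≥0∞} (hA : Measurable A) (hB : Measurable B) :
    ∫⁻ ξ, ∫⁻ η, A η * B (ξ - η) = (∫⁻ ξ, A ξ) * ∫⁻ ξ, B ξ := by
  rw [lintegral_lintegral_swap]
  · have : ∀ η, ∫⁻ ξ, A η * B (ξ - η) = A η * ∫⁻ ξ, B ξ := by
      intro η
      rw [lintegral_const_mul _ (by fun_prop), lintegral_sub_right_eq_self (μ := volume) B η]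
    simp only [this]
    rw [lintegral_mul_const _ hA]
  · exact Measurable.aemeasurable (by fun_prop)

lemma ae_ne_zero {d : ℕ} (hd : 1 ≤ d) : ∀ᵐ ξ : Rd d, ξ ≠ 0 := by
  have : NeZero d := ⟨by omega⟩
  exact Measure.ae_ne volume 0

lemma region1 {d : ℕ} (hd : 1 ≤ d) {s1 s2 : ℝ} (h2 : s2 < d / 2) : ∃ C : ℝ≥0∞, C ≠ ⊤ ∧
    ∀ f g : Rd d → ℝ≥0∞, Measurable f → Measurable g →
    ∫⁻ ξ, WW d (2 * (s1 + s2 - d/2)) ξ *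
      (∫⁻ η in Metric.ball (0 : Rd d) (‖ξ‖/2), g η * f (ξ - η)) ^ 2 ≤
    C * ((∫⁻ ξ, WW d (2*s1) ξ * f ξ ^ 2) * ∫⁻ ξ, WW d (2*s2) ξ * g ξ ^ 2) := by
  obtain ⟨c, hc, hball⟩ := ball_int hd (γ := -(2*s2)) (by linarith)
  have hae := ae_ne_zero hd
  set K := c * ENNReal.ofReal ((1/2) ^ ((d:ℝ) + -(2*s2))) * ENNReal.ofReal (2 ^ |2*s1|) with hK
  have hKt : K ≠ ⊤ := ENNReal.mul_ne_top (ENNReal.mul_ne_top hc ENNReal.ofReal_ne_top)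
    ENNReal.ofReal_ne_top
  refine ⟨K, hKt, ?_⟩
  intro f g hf hg
  have hwm := fun t => WW_meas d t
  have key : ∀ ξ : Rd d, ξ ≠ 0 → WW d (2 * (s1 + s2 - d/2)) ξ *
      (∫⁻ η in Metric.ball (0 : Rd d) (‖ξ‖/2), g η * f (ξ - η)) ^ 2 ≤
      K * ∫⁻ η, (WW d (2*s2) η * g η ^ 2) * (WW d (2*s1) (ξ-η) * f (ξ-η) ^ 2) := by
    intro ξ hξ
    have hξ' : 0 < ‖ξ‖ := norm_pos_iff.2 hξ
    have e1 : ∫⁻ η in Metric.ball (0 : Rd d) (‖ξ‖/2), g η * f (ξ - η) =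
        ∫⁻ η in Metric.ball (0 : Rd d) (‖ξ‖/2), WW d (-s2) η * (WW d s2 η * g η * f (ξ - η)) := by
      apply lintegral_congr_ae
      filter_upwards [ae_restrict_of_ae hae] with η hη
      rw [← mul_assoc, ← mul_assoc, ← WW_add hη, neg_add_cancel, WW_zero, one_mul]
    have e2 : ∫⁻ η in Metric.ball (0 : Rd d) (‖ξ‖/2), WW d (-s2) η ^ 2 ≤
        c * ENNReal.ofReal ((1/2) ^ ((d:ℝ) + -(2*s2))) * WW d (d + -(2*s2)) ξ := by
      calc _ = ∫⁻ η in Metric.ball (0 : Rd d) (‖ξ‖/2), WW d (-(2*s2)) η := by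
            apply lintegral_congr_ae
            filter_upwards [ae_restrict_of_ae hae] with η hη
            rw [WW_sq hη]; ring_nf
        _ ≤ _ := hball _ (by positivity)
        _ = _ := by
          rw [mul_assoc, WW, ← ENNReal.ofReal_mul (by positivity),
            ← Real.mul_rpow (by norm_num) (by positivity)]
          ring_nf
    have e3 : WW d (2*s1) ξ *
        ∫⁻ η in Metric.ball (0 : Rd d) (‖ξ‖/2), (WW d s2 η * g η * f (ξ - η)) ^ 2 ≤
        ENNReal.ofReal (2 ^ |2*s1|) *
          ∫⁻ η, (WW d (2*s2) η * g η ^ 2) * (WW d (2*s1) (ξ-η) * f (ξ-η) ^ 2) := by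
      rw [← lintegral_const_mul' _ _ WW_ne_top, ← lintegral_const_mul' _ _ ENNReal.ofReal_ne_top]
      refine le_trans ?_ (setLIntegral_le_lintegral (Metric.ball (0 : Rd d) (‖ξ‖/2)) _)
      apply lintegral_mono_ae
      filter_upwards [ae_restrict_of_ae hae, ae_restrict_mem measurableSet_ball] with η hη hm
      rw [mem_ball_zero_iff] at hm
      have n1 : ‖ξ‖ ≤ ‖ξ - η‖ + ‖η‖ := by simpa using norm_add_le (ξ - η) η
      have n2 : ‖ξ - η‖ ≤ ‖ξ‖ + ‖η‖ := norm_sub_le _ _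
      have hne : ξ - η ≠ 0 := by
        rw [← norm_pos_iff]; linarith
      have := WW_comp hξ hne (K := 2) (by norm_num) (by linarith) (by linarith) (2*s1)
      calc _ ≤ (ENNReal.ofReal (2 ^ |2*s1|) * WW d (2*s1) (ξ-η)) *
            (WW d s2 η * g η * f (ξ - η)) ^ 2 := by gcongr
        _ = _ := by
          rw [mul_pow, mul_pow, WW_sq hη]; ring
    calc _ = WW d (2 * (s1 + s2 - d/2)) ξ * (∫⁻ η in Metric.ball (0 : Rd d) (‖ξ‖/2),
          WW d (-s2) η * (WW d s2 η * g η * f (ξ - η))) ^ 2 := by rw [e1]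
      _ ≤ WW d (2 * (s1 + s2 - d/2)) ξ *
          ((c * ENNReal.ofReal ((1/2) ^ ((d:ℝ) + -(2*s2))) * WW d (d + -(2*s2)) ξ) *
          ∫⁻ η in Metric.ball (0 : Rd d) (‖ξ‖/2), (WW d s2 η * g η * f (ξ - η)) ^ 2) := by
        gcongr
        refine (CS _ (hwm _).aemeasurable (Measurable.aemeasurable (by fun_prop))).trans ?_
        gcongr
      _ = c * ENNReal.ofReal ((1/2) ^ ((d:ℝ) + -(2*s2))) * (WW d (2*s1) ξ *
          ∫⁻ η in Metric.ball (0 : Rd d) (‖ξ‖/2), (WW d s2 η * g η * f (ξ - η)) ^ 2) := by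
        have hw : WW d (2*s1) ξ = WW d (2*(s1+s2-d/2)) ξ * WW d (d + -(2*s2)) ξ := by
          rw [← WW_add hξ]; congr 1; ring
        rw [hw]; ring
      _ ≤ _ := by
        rw [hK, mul_assoc _ (ENNReal.ofReal (2 ^ |2*s1|))]
        gcongr
  calc _ ≤ ∫⁻ ξ, K * ∫⁻ η, (WW d (2*s2) η * g η ^ 2) * (WW d (2*s1) (ξ-η) * f (ξ-η) ^ 2) := by
        apply lintegral_mono_ae
        filter_upwards [hae] with ξ hξ using key ξ hξ
    _ = _ := by
      rw [lintegral_const_mul' _ _ hKt, tonelli (A := fun η => WW d (2*s2) η * g η ^ 2)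
        (B := fun η => WW d (2*s1) η * f η ^ 2) (by fun_prop) (by fun_prop)]
      ring


lemma region2 {d : ℕ} (hd : 1 ≤ d) {s1 s2 : ℝ} (h1 : s1 < d / 2) : ∃ C : ℝ≥0∞, C ≠ ⊤ ∧
    ∀ f g : Rd d → ℝ≥0∞, Measurable f → Measurable g →
    ∫⁻ ξ, WW d (2 * (s1 + s2 - d/2)) ξ *
      (∫⁻ η in Metric.ball ξ (‖ξ‖/2), g η * f (ξ - η)) ^ 2 ≤
    C * ((∫⁻ ξ, WW d (2*s1) ξ * f ξ ^ 2) * ∫⁻ ξ, WW d (2*s2) ξ * g ξ ^ 2) := by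
  obtain ⟨C, hC, h⟩ := region1 hd (s1 := s2) (s2 := s1) h1
  refine ⟨C, hC, fun f g hf hg => ?_⟩
  have := h g f hg hf
  rw [mul_comm (∫⁻ ξ, WW d (2*s1) ξ * f ξ ^ 2), add_comm s1 s2]
  refine le_trans (le_of_eq ?_) this
  congr 1; ext ξ
  congr 2
  rw [← lintegral_indicator measurableSet_ball, ← lintegral_indicator measurableSet_ball,
    ← lintegral_sub_left_eq_self _ ξ]
  congr 1; ext η
  by_cases hm : ‖η‖ < ‖ξ‖/2
  · rw [Set.indicator_of_mem, Set.indicator_of_mem]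
    · rw [sub_sub_cancel, mul_comm]
    · simpa using hm
    · simpa [mem_ball_iff_norm] using hm
  · rw [Set.indicator_of_notMem, Set.indicator_of_notMem]
    · simpa using hm
    · simpa [mem_ball_iff_norm] using hm

lemma region3 {d : ℕ} (hd : 1 ≤ d) {s1 s2 : ℝ} (ht : 0 < s1 + s2) : ∃ C : ℝ≥0∞, C ≠ ⊤ ∧
    ∀ f g : Rd d → ℝ≥0∞, Measurable f → Measurable g →
    ∫⁻ ξ, WW d (2 * (s1 + s2 - d/2)) ξ *
      (∫⁻ η in {η | ‖ξ‖/2 ≤ ‖η‖ ∧ ‖ξ‖/2 ≤ ‖ξ - η‖}, g η * f (ξ - η)) ^ 2 ≤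
    C * ((∫⁻ ξ, WW d (2*s1) ξ * f ξ ^ 2) * ∫⁻ ξ, WW d (2*s2) ξ * g ξ ^ 2) := by
  set t := s1 + s2 with htdef
  set e := (s2 - s1) / 2 with hedef
  obtain ⟨c, hc, hball⟩ := ball_int hd (γ := t - d) (by linarith)
  have hae := ae_ne_zero hd
  have hwm := fun t => WW_meas d t
  set K0 := ENNReal.ofReal (3 ^ |e|) with hK0
  have hK0t : K0 ≠ ⊤ := ENNReal.ofReal_ne_top
  set K1 := ENNReal.ofReal ((1/2) ^ (-t)) with hK1
  set K2 := c * ENNReal.ofReal (3 ^ ((d:ℝ) + (t - d))) with hK2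
  refine ⟨K0 ^ 2 * K1 * K2, by finiteness, ?_⟩
  intro f g hf hg
  set N1 := ∫⁻ ξ, WW d (2*s1) ξ * f ξ ^ 2 with hN1
  set I : Rd d → Rd d → ℝ≥0∞ := fun ξ η =>
    Set.indicator {p : Rd d × Rd d | ‖p.1‖ < 3 * ‖p.2‖} 1 (ξ, η) with hI
  have hIm : Measurable (fun p : Rd d × Rd d => I p.1 p.2) := by
    exact measurable_one.indicator (measurableSet_lt (by fun_prop) (by fun_prop))
  have hS : ∀ ξ : Rd d, MeasurableSet {η : Rd d | ‖ξ‖/2 ≤ ‖η‖ ∧ ‖ξ‖/2 ≤ ‖ξ - η‖} := by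
    intro ξ
    have q1 : MeasurableSet {η : Rd d | ‖ξ‖/2 ≤ ‖η‖} :=
      measurableSet_le (by fun_prop) (by fun_prop)
    have q2 : MeasurableSet {η : Rd d | ‖ξ‖/2 ≤ ‖ξ - η‖} :=
      measurableSet_le (by fun_prop) (by fun_prop)
    exact q1.inter q2
  have key : ∀ ξ : Rd d, ξ ≠ 0 → WW d (2 * (t - d/2)) ξ *
      (∫⁻ η in {η | ‖ξ‖/2 ≤ ‖η‖ ∧ ‖ξ‖/2 ≤ ‖ξ - η‖}, g η * f (ξ - η)) ^ 2 ≤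
      (K0 ^ 2 * K1 * N1) * ∫⁻ η, WW d (t - d) ξ * (I ξ η * (WW d (2*e) η * g η ^ 2)) := by
    intro ξ hξ
    have hξ' : 0 < ‖ξ‖ := norm_pos_iff.2 hξ
    have hne : ∀ η ∈ {η : Rd d | ‖ξ‖/2 ≤ ‖η‖ ∧ ‖ξ‖/2 ≤ ‖ξ - η‖}, η ≠ 0 ∧ ξ - η ≠ 0 := by
      intro η hη
      constructor
      · rw [← norm_pos_iff]; linarith [hη.1]
      · rw [← norm_pos_iff]; linarith [hη.2]
    have e1 : ∫⁻ η in {η | ‖ξ‖/2 ≤ ‖η‖ ∧ ‖ξ‖/2 ≤ ‖ξ - η‖}, g η * f (ξ - η) ≤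
        K0 * ∫⁻ η in {η | ‖ξ‖/2 ≤ ‖η‖ ∧ ‖ξ‖/2 ≤ ‖ξ - η‖},
          (WW d e η * g η) * (WW d (-e) (ξ - η) * f (ξ - η)) := by
      rw [← lintegral_const_mul' _ _ hK0t]
      apply setLIntegral_mono' (hS ξ)
      intro η hη
      obtain ⟨n1, n2⟩ := hne η hη
      have m1 : ‖ξ - η‖ ≤ ‖ξ‖ + ‖η‖ := norm_sub_le _ _
      have m2 : ‖η‖ ≤ ‖ξ‖ + ‖ξ - η‖ := by simpa using norm_sub_le ξ (ξ - η)
      have := WW_comp n2 n1 (K := 3) (by norm_num) (by linarith [hη.1]) (by linarith [hη.2]) e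
      calc g η * f (ξ - η) = (WW d e (ξ - η) * WW d (-e) (ξ - η)) * (g η * f (ξ - η)) := by
            rw [← WW_add n2, add_neg_cancel, WW_zero, one_mul]
        _ ≤ ((K0 * WW d e η) * WW d (-e) (ξ - η)) * (g η * f (ξ - η)) := by gcongr
        _ = _ := by ring
    have e2 : ∫⁻ η in {η | ‖ξ‖/2 ≤ ‖η‖ ∧ ‖ξ‖/2 ≤ ‖ξ - η‖}, (WW d e η * g η) ^ 2 ≤
        ∫⁻ η, I ξ η * (WW d (2*e) η * g η ^ 2) := by
      refine le_trans ?_ (setLIntegral_le_lintegral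
        {η : Rd d | ‖ξ‖/2 ≤ ‖η‖ ∧ ‖ξ‖/2 ≤ ‖ξ - η‖} _)
      apply setLIntegral_mono' (hS ξ)
      intro η hη
      obtain ⟨n1, n2⟩ := hne η hη
      have hp := norm_pos_iff.2 n1
      have : I ξ η = 1 := by
        simp only [hI]
        rw [Set.indicator_of_mem]
        · rfl
        · simp only [Set.mem_ofPred_eq]; linarith [hη.1]
      rw [this, mul_pow, WW_sq n1, one_mul]
    have e3 : ∫⁻ η in {η | ‖ξ‖/2 ≤ ‖η‖ ∧ ‖ξ‖/2 ≤ ‖ξ - η‖}, (WW d (-e) (ξ - η) * f (ξ - η)) ^ 2 ≤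
        K1 * WW d (-t) ξ * N1 := by
      have : N1 = ∫⁻ η, WW d (2*s1) (ξ - η) * f (ξ - η) ^ 2 := by
        rw [hN1, ← lintegral_sub_left_eq_self _ ξ]
      rw [this, ← lintegral_const_mul' _ _ (by unfold WW; finiteness)]
      refine le_trans ?_ (setLIntegral_le_lintegral
        {η : Rd d | ‖ξ‖/2 ≤ ‖η‖ ∧ ‖ξ‖/2 ≤ ‖ξ - η‖} _)
      apply setLIntegral_mono' (hS ξ)
      intro η hη
      obtain ⟨n1, n2⟩ := hne η hη
      have hw : WW d (-t) (ξ - η) ≤ K1 * WW d (-t) ξ := by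
        rw [hK1, WW, WW, ← ENNReal.ofReal_mul (by positivity),
          ← Real.mul_rpow (by norm_num) (by positivity)]
        apply ENNReal.ofReal_le_ofReal
        apply Real.rpow_le_rpow_of_nonpos (by positivity) _ (by linarith)
        linarith [hη.2]
      calc _ = WW d (-t) (ξ - η) * (WW d (2*s1) (ξ - η) * f (ξ - η) ^ 2) := by
            rw [mul_pow, WW_sq n2, ← mul_assoc, ← WW_add n2]
            congr 2; rw [hedef, htdef]; ring
        _ ≤ _ := by gcongr
    calc _ ≤ WW d (2 * (t - d/2)) ξ * (K0 * ∫⁻ η in {η | ‖ξ‖/2 ≤ ‖η‖ ∧ ‖ξ‖/2 ≤ ‖ξ - η‖},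
          (WW d e η * g η) * (WW d (-e) (ξ - η) * f (ξ - η))) ^ 2 := by gcongr
      _ ≤ WW d (2 * (t - d/2)) ξ * (K0 ^ 2 * ((∫⁻ η, I ξ η * (WW d (2*e) η * g η ^ 2)) *
          (K1 * WW d (-t) ξ * N1))) := by
        rw [mul_pow]
        gcongr
        refine (CS _ (Measurable.aemeasurable (by fun_prop))
          (Measurable.aemeasurable (by fun_prop))).trans ?_
        gcongr
      _ = _ := by
        rw [lintegral_const_mul' _ _ WW_ne_top]
        have hw : WW d (t - d) ξ = WW d (2 * (t - d/2)) ξ * WW d (-t) ξ := by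
          rw [← WW_add hξ]; congr 1; ring
        rw [hw]; ring
  calc _ ≤ ∫⁻ ξ, (K0 ^ 2 * K1 * N1) *
          ∫⁻ η, WW d (t - d) ξ * (I ξ η * (WW d (2*e) η * g η ^ 2)) := by
        apply lintegral_mono_ae
        filter_upwards [hae] with ξ hξ using key ξ hξ
    _ = (K0 ^ 2 * K1 * N1) *
          ∫⁻ η, ∫⁻ ξ, WW d (t - d) ξ * (I ξ η * (WW d (2*e) η * g η ^ 2)) := by
        have hm : Measurable (fun p : Rd d × Rd d =>
            WW d (t - d) p.1 * (I p.1 p.2 * (WW d (2*e) p.2 * g p.2 ^ 2))) := by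
          fun_prop
        rw [lintegral_const_mul _ hm.lintegral_prod_right', lintegral_lintegral_swap hm.aemeasurable]
    _ ≤ (K0 ^ 2 * K1 * N1) * ∫⁻ η, K2 * (WW d (2*s2) η * g η ^ 2) := by
        refine mul_le_mul_right ?_ _
        apply lintegral_mono_ae
        filter_upwards [hae] with η hη
        have hp := norm_pos_iff.2 hη
        calc _ = ∫⁻ ξ, (Metric.ball (0 : Rd d) (3 * ‖η‖)).indicator (WW d (t - d)) ξ *
              (WW d (2*e) η * g η ^ 2) := by
              congr 1; ext ξ
              simp only [hI]
              by_cases hm : ‖ξ‖ < 3 * ‖η‖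
              · rw [Set.indicator_of_mem, Set.indicator_of_mem]
                · simp
                · simpa using hm
                · simpa using hm
              · rw [Set.indicator_of_notMem, Set.indicator_of_notMem]
                · simp
                · simpa using hm
                · simpa using hm
          _ = (∫⁻ ξ in Metric.ball (0 : Rd d) (3 * ‖η‖), WW d (t - d) ξ) *
              (WW d (2*e) η * g η ^ 2) := by
              rw [lintegral_mul_const _ ((hwm _).indicator measurableSet_ball),
                lintegral_indicator measurableSet_ball]
          _ ≤ (K2 * WW d (d + (t - d)) η) * (WW d (2*e) η * g η ^ 2) := by
              gcongr
              refine (hball _ (by positivity)).trans (le_of_eq ?_)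
              rw [hK2, mul_assoc, WW, ← ENNReal.ofReal_mul (by positivity),
                ← Real.mul_rpow (by norm_num) (by positivity)]
          _ = _ := by
              have hw : WW d (2*s2) η = WW d (d + (t - d)) η * WW d (2*e) η := by
                rw [← WW_add hη]; congr 1; rw [hedef, htdef]; ring
              rw [hw]; ring
    _ = _ := by
        rw [lintegral_const_mul _ (by fun_prop)]; ring

lemma bilin {d : ℕ} (hd : 1 ≤ d) {s1 s2 : ℝ} (h1 : s1 < d / 2) (h2 : s2 < d / 2)
    (ht : 0 < s1 + s2) : ∃ C : ℝ≥0∞, C ≠ ⊤ ∧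
    ∀ f g : Rd d → ℝ≥0∞, Measurable f → Measurable g →
    ∫⁻ ξ, WW d (2 * (s1 + s2 - d/2)) ξ * (∫⁻ η, g η * f (ξ - η)) ^ 2 ≤
    C * ((∫⁻ ξ, WW d (2*s1) ξ * f ξ ^ 2) * ∫⁻ ξ, WW d (2*s2) ξ * g ξ ^ 2) := by
  obtain ⟨C1, hC1, H1⟩ := region1 hd (s1 := s1) h2
  obtain ⟨C2, hC2, H2⟩ := region2 hd (s2 := s2) h1
  obtain ⟨C3, hC3, H3⟩ := region3 hd ht
  refine ⟨4 * (C1 + C2 + C3), by finiteness, fun f g hf hg => ?_⟩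
  have hwm := WW_meas d (2 * (s1 + s2 - d/2))
  have sq2 : ∀ x y : ℝ≥0∞, (x + y) ^ 2 ≤ 2 * (x ^ 2 + y ^ 2) := by
    intro x y
    have := ENNReal.rpow_add_le_mul_rpow_add_rpow x y (p := 2) (by norm_num)
    norm_num at this
    exact this
  have sq3 : ∀ x y z : ℝ≥0∞, (x + y + z) ^ 2 ≤ 4 * (x ^ 2 + y ^ 2 + z ^ 2) := by
    intro x y z
    calc _ ≤ 2 * ((x + y) ^ 2 + z ^ 2) := sq2 _ _
      _ ≤ 2 * (2 * (x ^ 2 + y ^ 2) + 2 * z ^ 2) := by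
        gcongr
        · exact sq2 _ _
        · rw [two_mul]; exact le_self_add
      _ = _ := by ring
  have gf : Measurable (fun p : Rd d × Rd d => g p.2 * f (p.1 - p.2)) := by fun_prop
  have mm : ∀ T : Rd d → Set (Rd d), MeasurableSet {p : Rd d × Rd d | p.2 ∈ T p.1} →
      Measurable (fun ξ => ∫⁻ η in T ξ, g η * f (ξ - η)) := by
    intro T hT
    have : (fun ξ => ∫⁻ η in T ξ, g η * f (ξ - η)) =
        fun ξ => ∫⁻ η, {p : Rd d × Rd d | p.2 ∈ T p.1}.indicator
          (fun p : Rd d × Rd d => g p.2 * f (p.1 - p.2)) (ξ, η) := by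
      ext ξ
      have hTξ : MeasurableSet (T ξ) := measurable_prodMk_left (x := ξ) hT
      rw [← lintegral_indicator hTξ]
      rfl
    rw [this]
    exact (gf.indicator hT).lintegral_prod_right'
  set A := fun ξ : Rd d => ∫⁻ η in Metric.ball (0 : Rd d) (‖ξ‖/2), g η * f (ξ - η) with hA
  set B := fun ξ : Rd d => ∫⁻ η in Metric.ball ξ (‖ξ‖/2), g η * f (ξ - η) with hB
  set D := fun ξ : Rd d => ∫⁻ η in {η | ‖ξ‖/2 ≤ ‖η‖ ∧ ‖ξ‖/2 ≤ ‖ξ - η‖}, g η * f (ξ - η) with hD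
  have mA : Measurable A := by
    apply mm
    simp only [mem_ball_zero_iff]
    exact measurableSet_lt (by fun_prop) (by fun_prop)
  have mB : Measurable B := by
    apply mm
    simp only [mem_ball_iff_norm]
    exact measurableSet_lt (by fun_prop) (by fun_prop)
  have split : ∀ ξ, ∫⁻ η, g η * f (ξ - η) ≤ A ξ + B ξ + D ξ := by
    intro ξ
    rw [← setLIntegral_univ]
    have : (Set.univ : Set (Rd d)) ⊆ (Metric.ball (0 : Rd d) (‖ξ‖/2) ∪ Metric.ball ξ (‖ξ‖/2)) ∪
        {η | ‖ξ‖/2 ≤ ‖η‖ ∧ ‖ξ‖/2 ≤ ‖ξ - η‖} := by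
      intro η _
      simp only [Set.mem_union, mem_ball_iff_norm, sub_zero, Set.mem_ofPred_eq,
        norm_sub_rev η ξ]
      by_cases h : ‖η‖ < ‖ξ‖/2
      · exact Or.inl (Or.inl h)
      · by_cases h' : ‖ξ - η‖ < ‖ξ‖/2
        · exact Or.inl (Or.inr h')
        · exact Or.inr ⟨not_lt.1 h, not_lt.1 h'⟩
    refine (lintegral_mono_set this).trans ((lintegral_union_le _ _ _).trans ?_)
    exact add_le_add (lintegral_union_le _ _ _) le_rfl
  calc _ ≤ ∫⁻ ξ, 4 * (WW d (2 * (s1 + s2 - d/2)) ξ * A ξ ^ 2 +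
        WW d (2 * (s1 + s2 - d/2)) ξ * B ξ ^ 2 + WW d (2 * (s1 + s2 - d/2)) ξ * D ξ ^ 2) := by
        apply lintegral_mono
        intro ξ
        calc _ ≤ WW d (2 * (s1 + s2 - d/2)) ξ * (4 * (A ξ ^ 2 + B ξ ^ 2 + D ξ ^ 2)) := by
              simp only
              gcongr
              exact le_trans (pow_le_pow_left₀ zero_le (split ξ) 2) (sq3 _ _ _)
          _ = _ := by ring
    _ = 4 * ((∫⁻ ξ, WW d (2 * (s1 + s2 - d/2)) ξ * A ξ ^ 2) +
        (∫⁻ ξ, WW d (2 * (s1 + s2 - d/2)) ξ * B ξ ^ 2) +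
        ∫⁻ ξ, WW d (2 * (s1 + s2 - d/2)) ξ * D ξ ^ 2) := by
        rw [lintegral_const_mul' _ _ (by norm_num), lintegral_add_left (by fun_prop),
          lintegral_add_left (by fun_prop)]
    _ ≤ _ := mul_le_mul_right (add_le_add (add_le_add (H1 f g hf hg) (H2 f g hf hg))
        (H3 f g hf hg)) 4
    _ = _ := by ring


open FourierTransform in
lemma convH_meas {d : ℕ} {a : ℕ → Rd d → ℂ} (ha : ∀ i, Integrable (a i)) (j : ℕ) :
    Measurable (convH d a j) := by
  have hc : ∀ i, Measurable (fun ξ => ‖𝓕 (a i) ξ‖ₑ) := fun i =>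
    (contF (ha i)).measurable.enorm
  induction j with
  | zero => exact hc 0
  | succ j ih =>
    have hc' := hc (j+1)
    have : Measurable (fun p : Rd d × Rd d => ‖𝓕 (a (j+1)) p.2‖ₑ * convH d a j (p.1 - p.2)) :=
      (hc'.comp measurable_snd).mul (ih.comp (measurable_fst.sub measurable_snd))
    exact this.lintegral_prod_right'

open FourierTransform in
lemma convH_bound {d k : ℕ} (hd : 1 ≤ d) (hk : 2 ≤ k) {s : ℝ}
    (hs1 : (d:ℝ) / 2 - (d:ℝ) / k < s) (hs2 : s < (d:ℝ) / 2) (j : ℕ) (hj : j + 1 ≤ k) :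
    ∃ C : ℝ≥0∞, C ≠ ⊤ ∧ ∀ a : ℕ → Rd d → ℂ, (∀ i, Integrable (a i)) →
      ∫⁻ ξ, WW d (2 * ((j+1) * s - j * d / 2)) ξ * convH d a j ξ ^ 2 ≤
        C * ∏ i ∈ Finset.range (j+1), ∫⁻ ξ, WW d (2 * s) ξ * ‖𝓕 (a i) ξ‖ₑ ^ 2 := by
  induction j with
  | zero =>
    refine ⟨1, by simp, fun a ha => le_of_eq ?_⟩
    simp [convH]
  | succ j ih =>
    obtain ⟨C, hC, H⟩ := ih (by omega)
    have hk0 : (0:ℝ) < k := by positivity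
    have hd0 : (0:ℝ) < d := by exact_mod_cast hd
    have hjk : (j:ℝ) + 2 ≤ k := by exact_mod_cast (by omega : j + 2 ≤ k)
    have hj0 : (0:ℝ) ≤ j := by positivity
    have b1 : ((j:ℝ)+1) * s - j * d / 2 < d / 2 := by nlinarith
    have b2 : 0 < (((j:ℝ)+1) * s - j * d / 2) + s := by
      have h3 : ((j:ℝ)+2) * (d / k) ≤ d := by
        rw [mul_div_assoc', div_le_iff₀ hk0]; nlinarith
      have h4 : ((j:ℝ)+2) * ((d:ℝ) / 2 - (d:ℝ) / k) < (j+2) * s := by gcongr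
      nlinarith
    obtain ⟨C', hC', H'⟩ := bilin hd b1 hs2 b2
    refine ⟨C' * C, by finiteness, fun a ha => ?_⟩
    have h := H' (convH d a j) (fun ξ => ‖𝓕 (a (j+1)) ξ‖ₑ) (convH_meas ha j)
      (contF (ha (j+1))).measurable.enorm
    have e' : (2 * ((((j+1:ℕ):ℝ) + 1) * s - ((j+1:ℕ):ℝ) * d / 2)) =
      2 * (((j:ℝ)+1) * s - j * d / 2 + s - d / 2) := by push_cast; ring
    rw [e']
    refine h.trans ?_
    rw [Finset.prod_range_succ, mul_assoc]
    refine mul_le_mul_right ?_ _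
    rw [← mul_assoc]
    exact mul_le_mul_left (H a ha) _

lemma hSobC_eq (d : ℕ) (s : ℝ) (g : Rd d → ℂ) :
    hSobC d s g = (∫⁻ ξ, WW d (2 * s) ξ * ‖g ξ‖ₑ ^ 2) ^ (1/2 : ℝ) := by
  unfold hSobC WW
  congr 2; ext ξ
  rw [ENNReal.ofReal_mul (by positivity), ENNReal.ofReal_pow (by positivity), ofReal_norm]

lemma fullP_prod (d : ℕ) (a : ℕ → Rd d → ℂ) (j : ℕ) :
    fullP d a j = fun x => ∏ i ∈ Finset.range (j+1), a i x := by
  induction j with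
  | zero => ext x; simp [fullP]
  | succ j ih => ext x; rw [Finset.prod_range_succ, fullP, ih]; rfl


/-- product law (2.4) in homogeneous Sobolev spaces.  Let `d ≥ 1`,
`k ≥ 2` and `d/2 − d/k < s < d/2`.  There is `C = C(d,k,s)` such that for all
`a₁, …, a_k ∈ Ḣ^s(ℝ^d)` (integrable, so that their Fourier transforms are honest locally
integrable functions), the product lies in `Ḣ^{ks−(k−1)d/2}` with
`‖a₁⋯a_k‖_{Ḣ^{ks−(k−1)d/2}} ≤ C ‖a₁‖_{Ḣ^s} ⋯ ‖a_k‖_{Ḣ^s}`. -/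
theorem statement8 (d k : ℕ) (hd : 1 ≤ d) (hk : 2 ≤ k) (s : ℝ)
    (hs1 : (d:ℝ) / 2 - (d:ℝ) / k < s) (hs2 : s < (d:ℝ) / 2) :
    ∃ C > (0:ℝ), ∀ a : Fin k → Rd d → ℂ,
      (∀ ℓ, MeasureTheory.Integrable (a ℓ)) →
      (∀ ℓ, hSobC d s (FourierTransform.fourier (a ℓ)) < ⊤) →
      MeasureTheory.Integrable (fun x : Rd d => ∏ ℓ, a ℓ x) →
      hSobC d ((k:ℝ) * s - ((k:ℝ) - 1) * (d:ℝ) / 2)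
          (FourierTransform.fourier (fun x : Rd d => ∏ ℓ, a ℓ x)) ≤
        ENNReal.ofReal C * ∏ ℓ, hSobC d s (FourierTransform.fourier (a ℓ)) := by
  obtain ⟨C, hC, H⟩ := convH_bound hd hk hs1 hs2 (k-1) (by omega)
  refine ⟨(C ^ (1/2:ℝ)).toReal + 1, by positivity, ?_⟩
  intro a ha hA _
  set b : ℕ → Rd d → ℂ := fun i => if h : i < k then a ⟨i, h⟩ else 0 with hb
  have hbF : ∀ i : Fin k, b i = a i := fun i => by simp [hb]
  have hbi : ∀ i, Integrable (b i) := by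
    intro i
    by_cases h : i < k
    · simp only [hb, h, dif_pos]; exact ha _
    · simp only [hb, h, dif_neg, not_false_eq_true]; exact integrable_zero _ _ _
  have hbA : ∀ i, hSobC d s (FourierTransform.fourier (b i)) < ⊤ := by
    intro i
    by_cases h : i < k
    · simp only [hb, h, dif_pos]; exact hA _
    · simp only [hb, h, dif_neg, not_false_eq_true]
      have : FourierTransform.fourier (0 : Rd d → ℂ) = 0 := by
        ext ξ; simp [Real.fourier_eq]
      rw [this, hSobC_eq]; simp
  have hkk : k - 1 + 1 = k := by omega
  have hprod : (fun x : Rd d => ∏ ℓ, a ℓ x) = fullP d b (k-1) := by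
    rw [fullP_prod, hkk]
    ext x
    rw [← Fin.prod_univ_eq_prod_range (fun i => b i x) k]
    simp only [hbF]
  have hexp : (k:ℝ) * s - ((k:ℝ) - 1) * (d:ℝ) / 2 =
      (((k-1:ℕ):ℝ) + 1) * s - ((k-1:ℕ):ℝ) * d / 2 := by
    rw [Nat.cast_sub (by omega)]; push_cast; ring
  have hP := H b hbi
  rw [hkk, ← Fin.prod_univ_eq_prod_range
    (fun i => ∫⁻ ξ, WW d (2 * s) ξ * ‖FourierTransform.fourier (b i) ξ‖ₑ ^ 2) k] at hP
  simp only [hbF] at hP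
  rw [hprod, hexp, hSobC_eq]
  simp only [hSobC_eq]
  rw [ENNReal.prod_rpow_of_nonneg (by norm_num)]
  calc _ ≤ (C * ∏ i : Fin k, ∫⁻ ξ, WW d (2 * s) ξ *
        ‖FourierTransform.fourier (a i) ξ‖ₑ ^ 2) ^ (1/2 : ℝ) := by
        gcongr
        refine le_trans (lintegral_mono fun ξ => ?_) hP
        gcongr
        exact fullP_bound hk hbi hs1 hbA ξ
    _ = C ^ (1/2:ℝ) * _ := ENNReal.mul_rpow_of_nonneg _ _ (by norm_num)
    _ ≤ _ := by
        gcongr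
        rw [ENNReal.ofReal_add (by positivity) (by norm_num), ENNReal.ofReal_toReal (by finiteness)]
        exact le_self_add

end
end
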